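/- Let K be a field of characteristic zero and let A, B, C, D be finite-dimensional K-vector spaces of dimensions a, b, c, d ≥ 2. The homogeneous ideal of σ_2(PA* × PB* × PC* × PD*) ⊂ P(A*⊗B*⊗C*⊗D*) is generated in degree three by the modules defining the subspace variety Sub_{2,2,2,2} (namely the irreducible modules in Λ^3A ⊗ Λ^3(B⊗C⊗D) and its permutations, minus redundancies, i.e., the 3×3 minors of the one-factor-versus-three-factor flattenings) together with two copies of the module S_{21}A ⊗ S_{21}B ⊗ S_{21}C ⊗ S_{21}D arising from the 3×3 minors of the two-factor-versus-two-factor flattenings such as (A⊗B)⊗(C⊗D). In particular the Garcia-Stillman-Sturmfels conjecture holds for four factors: the ideal of σ_2 is generated by the 3×3 minors of all flattenings. -/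

import Mathlib

/-!
Statement 3: the ideal of σ₂(PA* × PB* × PC* × PD*) is generated in degree three by the
3×3 minors of the one-factor-versus-three-factor flattenings (the generators of the ideal
of the subspace variety Sub_{2,2,2,2}) together with the 3×3 minors of two of the
two-factor-versus-two-factor flattenings (which span the two copies of
S₂₁A ⊗ S₂₁B ⊗ S₂₁C ⊗ S₂₁D).  In particular the Garcia–Stillman–Sturmfels conjecture
holds for four factors: the ideal of σ₂ is generated by the 3×3 minors of all flattenings.
-/

open MvPolynomial

variable (K : Type) [Field K]

/-- `T` is a sum of at most `r` decomposable tensors in `A* ⊗ B* ⊗ C* ⊗ D*`. -/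
def RankLE {K : Type} [Field K] {a b c d : ℕ} (r : ℕ)
    (T : Fin a × Fin b × Fin c × Fin d → K) : Prop :=
  ∃ (u : Fin r → Fin a → K) (v : Fin r → Fin b → K) (w : Fin r → Fin c → K)
    (z : Fin r → Fin d → K),
    ∀ x, T x = ∑ i, u i x.1 * v i x.2.1 * w i x.2.2.1 * z i x.2.2.2

/-- The homogeneous ideal of (the affine cone over) `σ_r(PA* × PB* × PC* × PD*)`. -/
noncomputable def secantIdeal (a b c d r : ℕ) :
    Ideal (MvPolynomial (Fin a × Fin b × Fin c × Fin d) K) :=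
  ⨅ (T : Fin a × Fin b × Fin c × Fin d → K) (_ : RankLE r T),
    RingHom.ker (MvPolynomial.eval T)

section Minors


/-- 3×3 minors of the flattening `A* ⊗ (B ⊗ C ⊗ D)*`. -/
noncomputable def minorsA (a b c d : ℕ) :
    Set (MvPolynomial (Fin a × Fin b × Fin c × Fin d) K) :=
  { f | ∃ (ρ : Fin 3 → Fin a) (γ : Fin 3 → Fin b × Fin c × Fin d),
      f = Matrix.det (Matrix.of fun i j : Fin 3 => (X (ρ i, γ j) :
            MvPolynomial (Fin a × Fin b × Fin c × Fin d) K)) }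

/-- 3×3 minors of the flattening `B* ⊗ (A ⊗ C ⊗ D)*`. -/
noncomputable def minorsB (a b c d : ℕ) :
    Set (MvPolynomial (Fin a × Fin b × Fin c × Fin d) K) :=
  { f | ∃ (ρ : Fin 3 → Fin b) (γ : Fin 3 → Fin a × Fin c × Fin d),
      f = Matrix.det (Matrix.of fun i j : Fin 3 => (X ((γ j).1, ρ i, (γ j).2.1, (γ j).2.2) :
            MvPolynomial (Fin a × Fin b × Fin c × Fin d) K)) }

/-- 3×3 minors of the flattening `C* ⊗ (A ⊗ B ⊗ D)*`. -/
noncomputable def minorsC (a b c d : ℕ) :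
    Set (MvPolynomial (Fin a × Fin b × Fin c × Fin d) K) :=
  { f | ∃ (ρ : Fin 3 → Fin c) (γ : Fin 3 → Fin a × Fin b × Fin d),
      f = Matrix.det (Matrix.of fun i j : Fin 3 => (X ((γ j).1, (γ j).2.1, ρ i, (γ j).2.2) :
            MvPolynomial (Fin a × Fin b × Fin c × Fin d) K)) }

/-- 3×3 minors of the flattening `D* ⊗ (A ⊗ B ⊗ C)*`. -/
noncomputable def minorsD (a b c d : ℕ) :
    Set (MvPolynomial (Fin a × Fin b × Fin c × Fin d) K) :=
  { f | ∃ (ρ : Fin 3 → Fin d) (γ : Fin 3 → Fin a × Fin b × Fin c),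
      f = Matrix.det (Matrix.of fun i j : Fin 3 => (X ((γ j).1, (γ j).2.1, (γ j).2.2, ρ i) :
            MvPolynomial (Fin a × Fin b × Fin c × Fin d) K)) }

/-- 3×3 minors of the flattening `(A ⊗ B)* ⊗ (C ⊗ D)*`. -/
noncomputable def minorsAB_CD (a b c d : ℕ) :
    Set (MvPolynomial (Fin a × Fin b × Fin c × Fin d) K) :=
  { f | ∃ (ρ : Fin 3 → Fin a × Fin b) (γ : Fin 3 → Fin c × Fin d),
      f = Matrix.det (Matrix.of fun i j : Fin 3 => (X ((ρ i).1, (ρ i).2, (γ j).1, (γ j).2) :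
            MvPolynomial (Fin a × Fin b × Fin c × Fin d) K)) }

/-- 3×3 minors of the flattening `(A ⊗ C)* ⊗ (B ⊗ D)*`. -/
noncomputable def minorsAC_BD (a b c d : ℕ) :
    Set (MvPolynomial (Fin a × Fin b × Fin c × Fin d) K) :=
  { f | ∃ (ρ : Fin 3 → Fin a × Fin c) (γ : Fin 3 → Fin b × Fin d),
      f = Matrix.det (Matrix.of fun i j : Fin 3 => (X ((ρ i).1, (γ j).1, (ρ i).2, (γ j).2) :
            MvPolynomial (Fin a × Fin b × Fin c × Fin d) K)) }

/-- 3×3 minors of the flattening `(A ⊗ D)* ⊗ (B ⊗ C)*`. -/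
noncomputable def minorsAD_BC (a b c d : ℕ) :
    Set (MvPolynomial (Fin a × Fin b × Fin c × Fin d) K) :=
  { f | ∃ (ρ : Fin 3 → Fin a × Fin d) (γ : Fin 3 → Fin b × Fin c),
      f = Matrix.det (Matrix.of fun i j : Fin 3 => (X ((ρ i).1, (γ j).1, (γ j).2, (ρ i).2) :
            MvPolynomial (Fin a × Fin b × Fin c × Fin d) K)) }

end Minors

section WeightVectors

variable {τ κ 𝕜 : Type*} [Field 𝕜] [CharZero 𝕜]

/-- A subspace stable under commuting diagonal operators is contained in any subspace that
contains all of its weight vectors. -/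
theorem le_of_forall_weightVector_mem (D : κ → MvPolynomial τ 𝕜 →ₗ[𝕜] MvPolynomial τ 𝕜)
    (wt : κ → (τ →₀ ℕ) → ℕ)
    (hD : ∀ k f m, coeff m (D k f) = (wt k m : 𝕜) * coeff m f)
    (N J : Submodule 𝕜 (MvPolynomial τ 𝕜)) (hN : ∀ k, ∀ f ∈ N, D k f ∈ N)
    (h : ∀ f ∈ N, ∀ μ : κ → ℕ, (∀ k, D k f = (μ k : 𝕜) • f) → f ∈ J) : N ≤ J := by
  suffices H : ∀ n : ℕ, ∀ f ∈ N, f.support.card = n → f ∈ J from fun f hf => H _ f hf rfl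
  intro n
  induction n using Nat.strong_induction_on with
  | _ n ih =>
    intro f hf hn
    have key : ∀ k, ∀ m ∈ f.support, D k f - (wt k m : 𝕜) • f ∈ J := by
      intro k m hm
      refine ih _ ?_ _ (N.sub_mem (hN k f hf) (N.smul_mem _ hf)) rfl
      rw [← hn]
      apply Finset.card_lt_card
      rw [Finset.ssubset_iff_of_subset]
      · refine ⟨m, hm, ?_⟩
        simp [hD]
      · intro m' hm'
        rw [mem_support_iff] at hm' ⊢
        intro h0
        apply hm'
        simp [hD, h0]
    by_cases hsup : f.support = ∅
    · rw [MvPolynomial.support_eq_empty] at hsup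
      rw [hsup]; exact J.zero_mem
    obtain ⟨m, hm⟩ := Finset.nonempty_iff_ne_empty.mpr hsup
    by_cases hall : ∀ k, ∀ m' ∈ f.support, wt k m' = wt k m
    · refine h f hf (fun k => wt k m) fun k => ?_
      ext m'
      rw [hD, coeff_smul, smul_eq_mul]
      by_cases h0 : m' ∈ f.support
      · rw [hall k m' h0]
      · rw [notMem_support_iff.mp h0]; simp
    · push Not at hall
      obtain ⟨k, m', hm', hne⟩ := hall
      have h1 := J.sub_mem (key k m hm) (key k m' hm')
      have h2 : D k f - (wt k m : 𝕜) • f - (D k f - (wt k m' : 𝕜) • f)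
          = ((wt k m' : 𝕜) - wt k m) • f := by
        rw [sub_smul]; abel
      rw [h2] at h1
      refine (J.smul_mem_iff ?_).mp h1
      rw [sub_ne_zero]
      exact_mod_cast hne

end WeightVectors

section Polarization

variable {ι E τ 𝕜 : Type*} [Fintype E] [Field 𝕜]

/-- The polarization operator `∑ₑ x_{i,e} ∂/∂x_{j,e}` moving row `j` to row `i`, where the
variables are arranged in a matrix by `t`. -/
noncomputable def polarization (t : ι × E ≃ τ) (i j : ι) :
    Derivation 𝕜 (MvPolynomial τ 𝕜) (MvPolynomial τ 𝕜) :=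
  ∑ e, (X (t (i, e)) : MvPolynomial τ 𝕜) • pderiv (t (j, e))

theorem polarization_apply (t : ι × E ≃ τ) (i j : ι) (f : MvPolynomial τ 𝕜) :
    polarization t i j f = ∑ e, X (t (i, e)) * pderiv (t (j, e)) f := by
  have h := congrFun (map_sum (Derivation.coeFnAddMonoidHom (R := 𝕜) (A := MvPolynomial τ 𝕜)
    (M := MvPolynomial τ 𝕜)) (fun e => (X (t (i, e)) : MvPolynomial τ 𝕜) • pderiv (t (j, e)))
    Finset.univ) f
  exact h.trans (by simp [Finset.sum_apply])

theorem polarization_X [DecidableEq ι] (t : ι × E ≃ τ) (i j k : ι) (e : E) :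
    polarization t i j (X (t (k, e)) : MvPolynomial τ 𝕜)
      = if k = j then X (t (i, e)) else 0 := by
  classical
  rw [polarization_apply]
  simp only [pderiv_X, Pi.single_apply, EmbeddingLike.apply_eq_iff_eq, Prod.mk.injEq]
  by_cases h : k = j
  · subst h
    simp
  · simp [h]

/-- Normally ordered product of two polarizations. -/
noncomputable def polarization₂ (t : ι × E ≃ τ) (a b c d : ι) (f : MvPolynomial τ 𝕜) :
    MvPolynomial τ 𝕜 :=
  ∑ e₁, ∑ e₂, X (t (a, e₁)) * X (t (c, e₂)) * pderiv (t (b, e₁)) (pderiv (t (d, e₂)) f)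

/-- Normally ordered product of three polarizations. -/
noncomputable def polarization₃ (t : ι × E ≃ τ) (a b c d g h : ι) (f : MvPolynomial τ 𝕜) :
    MvPolynomial τ 𝕜 :=
  ∑ e₁, ∑ e₂, ∑ e₃, X (t (a, e₁)) * X (t (c, e₂)) * X (t (g, e₃)) *
    pderiv (t (b, e₁)) (pderiv (t (d, e₂)) (pderiv (t (h, e₃)) f))

theorem polarization_polarization [DecidableEq ι] (t : ι × E ≃ τ)
    (a b c d : ι) (f : MvPolynomial τ 𝕜) :
    polarization t a b (polarization t c d f)
      = polarization₂ t a b c d f + if c = b then polarization t a d f else 0 := by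
  rw [polarization_apply t c d, map_sum]
  simp only [Derivation.leibniz, polarization_X, smul_eq_mul, Finset.sum_add_distrib]
  congr 1
  · rw [polarization₂, Finset.sum_comm]
    refine Finset.sum_congr rfl fun e₂ _ => ?_
    rw [polarization_apply, Finset.mul_sum]
    refine Finset.sum_congr rfl fun e₁ _ => ?_
    ring
  · split_ifs with h
    · rw [polarization_apply]
      exact Finset.sum_congr rfl fun e _ => mul_comm _ _
    · simp

theorem polarization_polarization₂ [DecidableEq ι] (t : ι × E ≃ τ)
    (a b c d g h : ι) (f : MvPolynomial τ 𝕜) :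
    polarization t a b (polarization₂ t c d g h f)
      = polarization₃ t a b c d g h f + (if c = b then polarization₂ t a d g h f else 0)
        + if g = b then polarization₂ t c d a h f else 0 := by
  rw [polarization₂, map_sum]
  simp only [map_sum, Derivation.leibniz, polarization_X, smul_eq_mul, Finset.sum_add_distrib,
    mul_add]
  rw [add_assoc]
  congr 1
  · rw [polarization₃]
    simp only [polarization_apply, Finset.mul_sum]
    refine Finset.sum_comm_cycle.trans ?_
    refine Finset.sum_congr rfl fun e₁ _ => Finset.sum_congr rfl fun e₂ _ =>
      Finset.sum_congr rfl fun e₃ _ => ?_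
    ring
  · rw [add_comm]
    congr 1
    · split_ifs with h'
      · rw [polarization₂]
        refine Finset.sum_congr rfl fun e₁ _ => Finset.sum_congr rfl fun e₂ _ => ?_
        ring
      · simp
    · split_ifs with h'
      · rw [polarization₂]
        refine Finset.sum_congr rfl fun e₁ _ => Finset.sum_congr rfl fun e₂ _ => ?_
        ring
      · simp

end Polarization

section Capelli

variable {ι E τ 𝕜 : Type*} [Fintype E] [Field 𝕜]

theorem polarization_self_coeff [CharZero 𝕜] (t : ι × E ≃ τ) (k : ι) (f : MvPolynomial τ 𝕜)
    (m : τ →₀ ℕ) :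
    coeff m (polarization t k k f) = ((∑ e, m (t (k, e)) : ℕ) : 𝕜) * coeff m f := by
  induction f using MvPolynomial.induction_on' with
  | monomial u c =>
    classical
    rw [polarization_apply]
    simp only [X_mul_pderiv_monomial]
    rw [← Finset.sum_smul, coeff_smul, coeff_monomial, nsmul_eq_mul]
    by_cases h : u = m
    · subst h; simp
    · simp [h]
  | add p q hp hq => simp only [map_add, coeff_add, hp, hq, mul_add]

/-- The weighted degree of a monomial giving each variable the weight of its row. -/
def rowHeight (t : ι × E ≃ τ) (w : ι → ℕ) (m : τ →₀ ℕ) : ℕ :=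
  m.sum fun x n => n * w (t.symm x).1

theorem polarization_mem_restrictSupport (t : ι × E ≃ τ) (w : ι → ℕ) {i j : ι} (hij : w i < w j)
    {n : ℕ} {f : MvPolynomial τ 𝕜}
    (hf : f ∈ restrictSupport 𝕜 {m | rowHeight t w m < n + 1}) :
    polarization t i j f ∈ restrictSupport 𝕜 {m | rowHeight t w m < n} := by
  classical
  rw [restrictSupport_eq_span] at hf
  induction hf using Submodule.span_induction with
  | mem x hx =>
    obtain ⟨m, hm, rfl⟩ := hx
    rw [polarization_apply]
    refine Submodule.sum_mem _ fun e _ => ?_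
    rw [pderiv_monomial, X, monomial_mul, monomial_mem_restrictSupport]
    by_cases h0 : m (t (j, e)) = 0
    · right; simp [h0]
    left
    obtain ⟨m', rfl⟩ : ∃ m', m = m' + Finsupp.single (t (j, e)) 1 :=
      ⟨m - Finsupp.single (t (j, e)) 1, by
        rw [tsub_add_cancel_of_le]
        simpa [Finsupp.single_le_iff] using Nat.one_le_iff_ne_zero.mpr h0⟩
    have hadd : ∀ p q : τ →₀ ℕ, rowHeight t w (p + q) = rowHeight t w p + rowHeight t w q :=
      fun p q => Finsupp.sum_add_index' (by simp) (by intros; ring)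
    have hs : ∀ k, rowHeight t w (Finsupp.single (t (k, e)) 1) = w k := fun k => by
      simp [rowHeight, Finsupp.sum_single_index]
    simp only [Set.mem_ofPred_eq, hadd, hs, add_tsub_cancel_right] at hm ⊢
    omega
  | zero => rw [map_zero]; exact Submodule.zero_mem _
  | add x y _ _ hx hy => rw [map_add]; exact Submodule.add_mem _ hx hy
  | smul a x _ hx => rw [Derivation.map_smul]; exact Submodule.smul_mem _ _ hx

/-- The Capelli operator on three rows, written through normally ordered products. -/
theorem capelli_mem (t : ι × E ≃ τ) (J : Ideal (MvPolynomial τ 𝕜))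
    (hJ : ∀ (ρ : Fin 3 → ι) (γ : Fin 3 → E),
      (Matrix.of fun a b => (X (t (ρ a, γ b)) : MvPolynomial τ 𝕜)).det ∈ J)
    (a b c : ι) (f : MvPolynomial τ 𝕜) :
    polarization₃ t a a b b c c f - polarization₃ t a a c b b c f - polarization₃ t b a a b c c f
      + polarization₃ t b a c b a c f + polarization₃ t c a a b b c f
      - polarization₃ t c a b b a c f ∈ J := by
  simp only [polarization₃, ← Finset.sum_sub_distrib, ← Finset.sum_add_distrib]
  refine J.sum_mem fun e₁ _ => J.sum_mem fun e₂ _ => J.sum_mem fun e₃ _ => ?_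
  have h := J.mul_mem_right (pderiv (t (a, e₁)) (pderiv (t (b, e₂)) (pderiv (t (c, e₃)) f)))
    (hJ ![a, b, c] ![e₁, e₂, e₃])
  rw [Matrix.det_fin_three] at h
  convert h using 1
  simp
  ring

theorem mem_of_forall_two_rows_mem [DecidableEq ι] [CharZero 𝕜] (t : ι × E ≃ τ)
    {i₀ i₁ : ι} (hne : i₀ ≠ i₁)
    (M : Submodule 𝕜 (MvPolynomial τ 𝕜)) (hM : ∀ i j, ∀ f ∈ M, polarization t i j f ∈ M)
    (J : Ideal (MvPolynomial τ 𝕜)) (hJD : ∀ i j, ∀ f ∈ J, polarization t i j f ∈ J)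
    (hJ : ∀ (ρ : Fin 3 → ι) (γ : Fin 3 → E),
      (Matrix.of fun a b => (X (t (ρ a, γ b)) : MvPolynomial τ 𝕜)).det ∈ J)
    (h : ∀ f ∈ M, f ∈ supported 𝕜 {x | (t.symm x).1 = i₀ ∨ (t.symm x).1 = i₁} → f ∈ J) :
    ∀ f ∈ M, f ∈ J := by
  set w : ι → ℕ := fun i => if i = i₀ then 0 else if i = i₁ then 1 else 2 with hw
  suffices H : ∀ n, ∀ f ∈ M, f ∈ restrictSupport 𝕜 {m | rowHeight t w m < n} → f ∈ J by
    intro f hf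
    refine H (f.support.sup (rowHeight t w) + 1) f hf ?_
    rw [mem_restrictSupport_iff]
    intro m hm
    exact Nat.lt_succ_of_le (Finset.le_sup (f := rowHeight t w) hm)
  intro n
  induction n with
  | zero =>
    intro f _ hf
    have : f = 0 := by
      rw [← MvPolynomial.support_eq_empty]
      rw [mem_restrictSupport_iff] at hf
      simpa using hf
    rw [this]; exact J.zero_mem
  | succ n ih =>
    have main := le_of_forall_weightVector_mem (fun k => (polarization t k k).toLinearMap)
      (fun k m => ∑ e, m (t (k, e))) (fun k f m => polarization_self_coeff t k f m)
      (M ⊓ restrictSupport 𝕜 {m | rowHeight t w m < n + 1}) (J.restrictScalars 𝕜) ?_ ?_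
    · exact fun f hf hf' => main ⟨hf, hf'⟩
    · rintro k f ⟨hf, hf'⟩
      refine ⟨hM k k f hf, ?_⟩
      rw [SetLike.mem_coe, mem_restrictSupport_iff] at hf' ⊢
      refine Set.Subset.trans (fun m hm => ?_) hf'
      simp only [Finset.mem_coe, mem_support_iff] at hm ⊢
      intro h0
      apply hm
      change coeff m (polarization t k k f) = 0
      rw [polarization_self_coeff, h0, mul_zero]
    · rintro f ⟨hf, hf'⟩ μ hμ
      change f ∈ J
      replace hμ : ∀ k, polarization t k k f = (μ k : 𝕜) • f := hμ
      have low : ∀ i j, w i < w j → polarization t i j f ∈ J := fun i j hij =>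
        ih _ (hM i j f hf) (polarization_mem_restrictSupport t w hij hf')
      by_cases hsupp : ∀ i, i ≠ i₀ → i ≠ i₁ → μ i = 0
      · refine h f hf ?_
        rw [mem_supported]
        intro x hx
        obtain ⟨m, hm, hxm⟩ := (mem_vars_iff_mem_support x).mp hx
        by_contra hcon
        simp only [Set.mem_ofPred_eq, not_or] at hcon
        have h1 := congrArg (coeff m) (hμ (t.symm x).1)
        rw [polarization_self_coeff, hsupp _ hcon.1 hcon.2, coeff_smul, Nat.cast_zero,
          zero_smul, mul_eq_zero, or_iff_left (mem_support_iff.mp hm), Nat.cast_eq_zero,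
          Finset.sum_eq_zero_iff] at h1
        have h2 := h1 (t.symm x).2 (Finset.mem_univ _)
        rw [Prod.mk.eta, Equiv.apply_symm_apply] at h2
        exact Finsupp.mem_support_iff.mp hxm h2
      · push Not at hsupp
        obtain ⟨c, hc0, hc1, hμc⟩ := hsupp
        have h01 := low i₀ i₁ (by simp [hw, hne.symm])
        have h0c := low i₀ c (by simp [hw, hc0, hc1])
        have h1c := low i₁ c (by simp [hw, hc0, hc1, hne.symm])
        have hcap := capelli_mem t J hJ i₀ i₁ c f
        have hs : ∀ (r : 𝕜) i j g, polarization t i j (r • g) = r • polarization t i j g :=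
          fun r i j g => Derivation.map_smul _ _ _
        have e1 := polarization_polarization₂ t i₀ i₀ i₁ i₁ c c f
        have e1' := polarization_polarization t i₁ i₁ c c f
        have e2 := polarization_polarization₂ t i₀ i₀ c i₁ i₁ c f
        have e2' := polarization_polarization t c i₁ i₁ c f
        have e3 := polarization_polarization₂ t i₁ i₀ i₀ i₁ c c f
        have e3' := polarization_polarization t i₀ i₁ c c f
        have e4 := polarization_polarization₂ t i₁ i₀ c i₁ i₀ c f
        have e4' := polarization_polarization t c i₁ i₀ c f
        have e5 := polarization_polarization₂ t c i₀ i₀ i₁ i₁ c f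
        have e5' := polarization_polarization t i₀ i₁ i₁ c f
        have e6 := polarization_polarization₂ t c i₀ i₁ i₁ i₀ c f
        have e6' := polarization_polarization t i₁ i₁ i₀ c f
        simp only [hc0, hc1, hne, hne.symm, if_true, if_false, add_zero, hμ, hs]
          at e1 e1' e2 e2' e3 e3' e4 e4' e5 e5' e6 e6'
        have smem : ∀ (r : 𝕜) g, g ∈ J → r • g ∈ J := fun r g hg =>
          (J.restrictScalars 𝕜).smul_mem r hg
        have q2 := hJD i₀ i₀ _ (hJD c i₁ _ h1c)
        have q3 := smem (μ c) _ (hJD i₁ i₀ _ h01)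
        have q4 := hJD i₁ i₀ _ (hJD c i₁ _ h0c)
        have q5 := hJD c i₀ _ (hJD i₀ i₁ _ h1c)
        have q5' := hJD c i₀ _ h0c
        have q6 := hJD c i₀ _ (hJD i₁ i₁ _ h0c)
        have q7 := hJD c i₁ _ h1c
        have hfin : ((μ c : 𝕜) * ((μ i₀ + 2) * (μ i₁ + 1))) • f ∈ J := by
          rw [eq_sub_of_add_eq e2'.symm] at e2 e4 e5
          rw [← e1'] at e1
          rw [← e3', ← e1'] at e3
          rw [← e4'] at e4
          rw [eq_sub_of_add_eq e5'.symm] at e5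
          rw [← e6', ← e1'] at e6
          simp only [hμ, hs, map_sub] at e1 e2 e3 e4 e5 e6
          rw [← e1, ← e2, eq_sub_of_add_eq e3.symm, eq_sub_of_add_eq e4.symm,
            eq_sub_of_add_eq e5.symm, eq_sub_of_add_eq e6.symm] at hcap
          have hsum := J.add_mem (J.sub_mem (J.add_mem (J.add_mem hcap q2) q3) q4)
            (J.add_mem (J.sub_mem (J.add_mem q7 q7) (J.sub_mem q5 q5')) q6)
          convert hsum using 1
          module
        refine ((J.restrictScalars 𝕜).smul_mem_iff ?_).mp hfin
        have hμc' : (μ c : 𝕜) ≠ 0 := by exact_mod_cast hμc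
        have : ((μ i₀ : 𝕜) + 2) * (μ i₁ + 1) ≠ 0 := by norm_cast
        exact mul_ne_zero hμc' this

end Capelli

section Minors

variable {P Q τ 𝕜 : Type*} [Field 𝕜]

/-- The `3 × 3` minors of the matrix of variables `t`. -/
def minorSet (𝕜 : Type*) [Field 𝕜] (t : P → Q → τ) : Set (MvPolynomial τ 𝕜) :=
  {f | ∃ (ρ : Fin 3 → P) (γ : Fin 3 → Q),
    f = (Matrix.of fun i j => (X (t (ρ i) (γ j)) : MvPolynomial τ 𝕜)).det}

/-- The ideal spanned by `S` is stable under the derivation `D`, tested on generators. -/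
def SpanStable (D : Derivation 𝕜 (MvPolynomial τ 𝕜) (MvPolynomial τ 𝕜))
    (S : Set (MvPolynomial τ 𝕜)) : Prop :=
  ∀ f ∈ S, D f ∈ Ideal.span S

theorem SpanStable.apply_mem {D : Derivation 𝕜 (MvPolynomial τ 𝕜) (MvPolynomial τ 𝕜)}
    {S : Set (MvPolynomial τ 𝕜)} (h : SpanStable D S) {f : MvPolynomial τ 𝕜}
    (hf : f ∈ Ideal.span S) : D f ∈ Ideal.span S := by
  induction hf using Submodule.span_induction with
  | mem x hx => exact h x hx
  | zero => rw [map_zero]; exact Ideal.zero_mem _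
  | add x y _ _ hx hy => rw [map_add]; exact Ideal.add_mem _ hx hy
  | smul a x hx' hx =>
    rw [smul_eq_mul, Derivation.leibniz]
    exact Ideal.add_mem _ (Ideal.mul_mem_left _ _ hx) (Ideal.mul_mem_right _ _ hx')

theorem SpanStable.union {D : Derivation 𝕜 (MvPolynomial τ 𝕜) (MvPolynomial τ 𝕜)}
    {S T : Set (MvPolynomial τ 𝕜)} (hS : SpanStable D S) (hT : SpanStable D T) :
    SpanStable D (S ∪ T) := by
  rintro f (hf | hf)
  · exact Ideal.span_mono Set.subset_union_left (hS f hf)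
  · exact Ideal.span_mono Set.subset_union_right (hT f hf)

theorem spanStable_minorSet_of_rows (t : P → Q → τ)
    (D : Derivation 𝕜 (MvPolynomial τ 𝕜) (MvPolynomial τ 𝕜)) (c : P → Prop) [DecidablePred c]
    (g : P → P) (h : ∀ p q, D (X (t p q)) = if c p then X (t (g p) q) else 0) :
    SpanStable D (minorSet 𝕜 t) := by
  rintro _ ⟨ρ, γ, rfl⟩
  have key : D (Matrix.of fun i j => (X (t (ρ i) (γ j)) : MvPolynomial τ 𝕜)).det
      = ∑ r : Fin 3, if c (ρ r) then
        (Matrix.of fun i j => (X (t (Function.update ρ r (g (ρ r)) i) (γ j)) :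
          MvPolynomial τ 𝕜)).det else 0 := by
    simp only [Matrix.det_fin_three, Fin.sum_univ_three, Matrix.of_apply, map_add, map_sub,
      Derivation.leibniz, h, smul_eq_mul, Function.update_apply]
    simp only [Fin.isValue, if_true, Fin.reduceEq, if_false]
    split_ifs <;> ring
  rw [key]
  refine Ideal.sum_mem _ fun r _ => ?_
  split_ifs
  · exact Ideal.subset_span ⟨_, _, rfl⟩
  · exact Ideal.zero_mem _

theorem minorSet_flip (t : P → Q → τ) : minorSet 𝕜 (fun q p => t p q) = minorSet 𝕜 t := by
  ext f
  constructor
  · rintro ⟨ρ, γ, rfl⟩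
    exact ⟨γ, ρ, (Matrix.det_transpose _).symm⟩
  · rintro ⟨ρ, γ, rfl⟩
    exact ⟨γ, ρ, (Matrix.det_transpose _).symm⟩

theorem spanStable_minorSet_of_cols (t : P → Q → τ)
    (D : Derivation 𝕜 (MvPolynomial τ 𝕜) (MvPolynomial τ 𝕜)) (c : Q → Prop) [DecidablePred c]
    (g : Q → Q) (h : ∀ p q, D (X (t p q)) = if c q then X (t p (g q)) else 0) :
    SpanStable D (minorSet 𝕜 t) := by
  rw [← minorSet_flip]
  exact spanStable_minorSet_of_rows _ D c g fun p q => h q p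

theorem derivation_mem_supported (D : Derivation 𝕜 (MvPolynomial τ 𝕜) (MvPolynomial τ 𝕜))
    {s : Set τ} (h : ∀ x ∈ s, D (X x) ∈ supported 𝕜 s) {f : MvPolynomial τ 𝕜}
    (hf : f ∈ supported 𝕜 s) : D f ∈ supported 𝕜 s := by
  rw [supported] at hf
  induction hf using Algebra.adjoin_induction with
  | mem x hx => obtain ⟨y, hy, rfl⟩ := hx; exact h y hy
  | algebraMap r => rw [Derivation.map_algebraMap]; exact Subalgebra.zero_mem _
  | add x y _ _ hx hy => rw [map_add]; exact Subalgebra.add_mem _ hx hy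
  | mul x y hx hy hx' hy' =>
    rw [Derivation.leibniz]
    exact Subalgebra.add_mem _ (Subalgebra.mul_mem _ hx hy') (Subalgebra.mul_mem _ hy hx')

theorem algHom_comp_derivation {τ' : Type*} (φ : MvPolynomial τ 𝕜 →ₐ[𝕜] MvPolynomial τ' 𝕜)
    (D : Derivation 𝕜 (MvPolynomial τ 𝕜) (MvPolynomial τ 𝕜))
    (D' : Derivation 𝕜 (MvPolynomial τ' 𝕜) (MvPolynomial τ' 𝕜))
    (h : ∀ x, φ (D (X x)) = D' (φ (X x))) (f : MvPolynomial τ 𝕜) : φ (D f) = D' (φ f) := by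
  induction f using MvPolynomial.induction_on with
  | C r => simp [← MvPolynomial.algebraMap_eq]
  | add p q hp hq => simp only [map_add, hp, hq]
  | mul_X p x hp => simp only [Derivation.leibniz, map_add, map_mul, smul_eq_mul, hp, h]

end Minors

section Secant

variable {𝕜 : Type} [Field 𝕜]

/-- The variables of a `4`-way tensor as a matrix with rows indexed by the first factor. -/
def rowsA (a b c d : ℕ) :
    Fin a × (Fin b × Fin c × Fin d) ≃ Fin a × Fin b × Fin c × Fin d :=
  Equiv.refl _

/-- The variables of a `4`-way tensor as a matrix with rows indexed by the second factor. -/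
def rowsB (a b c d : ℕ) :
    Fin b × (Fin a × Fin c × Fin d) ≃ Fin a × Fin b × Fin c × Fin d where
  toFun x := (x.2.1, x.1, x.2.2.1, x.2.2.2)
  invFun x := (x.2.1, x.1, x.2.2.1, x.2.2.2)

/-- The variables of a `4`-way tensor as a matrix with rows indexed by the third factor. -/
def rowsC (a b c d : ℕ) :
    Fin c × (Fin a × Fin b × Fin d) ≃ Fin a × Fin b × Fin c × Fin d where
  toFun x := (x.2.1, x.2.2.1, x.1, x.2.2.2)
  invFun x := (x.2.2.1, x.1, x.2.1, x.2.2.2)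

/-- The variables of a `4`-way tensor as a matrix with rows indexed by the fourth factor. -/
def rowsD (a b c d : ℕ) :
    Fin d × (Fin a × Fin b × Fin c) ≃ Fin a × Fin b × Fin c × Fin d where
  toFun x := (x.2.1, x.2.2.1, x.2.2.2, x.1)
  invFun x := (x.2.2.2, x.1, x.2.1, x.2.2.1)

/-- The minors of the four one-versus-three flattenings and of two of the two-versus-two
flattenings. -/
noncomputable def flatteningMinors (𝕜 : Type) [Field 𝕜] (a b c d : ℕ) :
    Set (MvPolynomial (Fin a × Fin b × Fin c × Fin d) 𝕜) :=
  minorsA 𝕜 a b c d ∪ minorsB 𝕜 a b c d ∪ minorsC 𝕜 a b c d ∪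
    minorsD 𝕜 a b c d ∪ minorsAB_CD 𝕜 a b c d ∪ minorsAC_BD 𝕜 a b c d

theorem polarization_rowsA_X {a b c d : ℕ} (i j : Fin a)
    (x : Fin a × Fin b × Fin c × Fin d) :
    polarization (rowsA a b c d) i j (X x : MvPolynomial _ 𝕜)
      = if x.1 = j then X (i, x.2.1, x.2.2.1, x.2.2.2) else 0 :=
  polarization_X (rowsA a b c d) i j x.1 (x.2.1, x.2.2.1, x.2.2.2)

theorem flatteningMinors_spanStable_rowsA (a b c d : ℕ) (i j : Fin a) :
    SpanStable (polarization (rowsA a b c d) i j) (flatteningMinors 𝕜 a b c d) := by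
  refine SpanStable.union (SpanStable.union (SpanStable.union (SpanStable.union
    (SpanStable.union ?_ ?_) ?_) ?_) ?_) ?_
  · exact spanStable_minorSet_of_rows
      (fun (p : Fin a) (q : Fin b × Fin c × Fin d) => (p, q)) _
      (fun p => p = j) (fun _ => i) fun _ _ => polarization_rowsA_X i j _
  · exact spanStable_minorSet_of_cols
      (fun (p : Fin b) (q : Fin a × Fin c × Fin d) => (q.1, p, q.2.1, q.2.2)) _
      (fun q => q.1 = j) (fun q => (i, q.2.1, q.2.2)) fun _ _ => polarization_rowsA_X i j _
  · exact spanStable_minorSet_of_cols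
      (fun (p : Fin c) (q : Fin a × Fin b × Fin d) => (q.1, q.2.1, p, q.2.2)) _
      (fun q => q.1 = j) (fun q => (i, q.2.1, q.2.2)) fun _ _ => polarization_rowsA_X i j _
  · exact spanStable_minorSet_of_cols
      (fun (p : Fin d) (q : Fin a × Fin b × Fin c) => (q.1, q.2.1, q.2.2, p)) _
      (fun q => q.1 = j) (fun q => (i, q.2.1, q.2.2)) fun _ _ => polarization_rowsA_X i j _
  · exact spanStable_minorSet_of_rows
      (fun (p : Fin a × Fin b) (q : Fin c × Fin d) => (p.1, p.2, q.1, q.2)) _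
      (fun p => p.1 = j) (fun p => (i, p.2)) fun _ _ => polarization_rowsA_X i j _
  · exact spanStable_minorSet_of_rows
      (fun (p : Fin a × Fin c) (q : Fin b × Fin d) => (p.1, q.1, p.2, q.2)) _
      (fun p => p.1 = j) (fun p => (i, p.2)) fun _ _ => polarization_rowsA_X i j _

theorem polarization_rowsB_X {a b c d : ℕ} (i j : Fin b)
    (x : Fin a × Fin b × Fin c × Fin d) :
    polarization (rowsB a b c d) i j (X x : MvPolynomial _ 𝕜)
      = if x.2.1 = j then X (x.1, i, x.2.2.1, x.2.2.2) else 0 :=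
  polarization_X (rowsB a b c d) i j x.2.1 (x.1, x.2.2.1, x.2.2.2)

theorem flatteningMinors_spanStable_rowsB (a b c d : ℕ) (i j : Fin b) :
    SpanStable (polarization (rowsB a b c d) i j) (flatteningMinors 𝕜 a b c d) := by
  refine SpanStable.union (SpanStable.union (SpanStable.union (SpanStable.union
    (SpanStable.union ?_ ?_) ?_) ?_) ?_) ?_
  · exact spanStable_minorSet_of_cols
      (fun (p : Fin a) (q : Fin b × Fin c × Fin d) => (p, q)) _
      (fun q => q.1 = j) (fun q => (i, q.2.1, q.2.2)) fun _ _ => polarization_rowsB_X i j _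
  · exact spanStable_minorSet_of_rows
      (fun (p : Fin b) (q : Fin a × Fin c × Fin d) => (q.1, p, q.2.1, q.2.2)) _
      (fun p => p = j) (fun _ => i) fun _ _ => polarization_rowsB_X i j _
  · exact spanStable_minorSet_of_cols
      (fun (p : Fin c) (q : Fin a × Fin b × Fin d) => (q.1, q.2.1, p, q.2.2)) _
      (fun q => q.2.1 = j) (fun q => (q.1, i, q.2.2)) fun _ _ => polarization_rowsB_X i j _
  · exact spanStable_minorSet_of_cols
      (fun (p : Fin d) (q : Fin a × Fin b × Fin c) => (q.1, q.2.1, q.2.2, p)) _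
      (fun q => q.2.1 = j) (fun q => (q.1, i, q.2.2)) fun _ _ => polarization_rowsB_X i j _
  · exact spanStable_minorSet_of_rows
      (fun (p : Fin a × Fin b) (q : Fin c × Fin d) => (p.1, p.2, q.1, q.2)) _
      (fun p => p.2 = j) (fun p => (p.1, i)) fun _ _ => polarization_rowsB_X i j _
  · exact spanStable_minorSet_of_cols
      (fun (p : Fin a × Fin c) (q : Fin b × Fin d) => (p.1, q.1, p.2, q.2)) _
      (fun q => q.1 = j) (fun q => (i, q.2)) fun _ _ => polarization_rowsB_X i j _

theorem polarization_rowsC_X {a b c d : ℕ} (i j : Fin c)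
    (x : Fin a × Fin b × Fin c × Fin d) :
    polarization (rowsC a b c d) i j (X x : MvPolynomial _ 𝕜)
      = if x.2.2.1 = j then X (x.1, x.2.1, i, x.2.2.2) else 0 :=
  polarization_X (rowsC a b c d) i j x.2.2.1 (x.1, x.2.1, x.2.2.2)

theorem flatteningMinors_spanStable_rowsC (a b c d : ℕ) (i j : Fin c) :
    SpanStable (polarization (rowsC a b c d) i j) (flatteningMinors 𝕜 a b c d) := by
  refine SpanStable.union (SpanStable.union (SpanStable.union (SpanStable.union
    (SpanStable.union ?_ ?_) ?_) ?_) ?_) ?_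
  · exact spanStable_minorSet_of_cols
      (fun (p : Fin a) (q : Fin b × Fin c × Fin d) => (p, q)) _
      (fun q => q.2.1 = j) (fun q => (q.1, i, q.2.2)) fun _ _ => polarization_rowsC_X i j _
  · exact spanStable_minorSet_of_cols
      (fun (p : Fin b) (q : Fin a × Fin c × Fin d) => (q.1, p, q.2.1, q.2.2)) _
      (fun q => q.2.1 = j) (fun q => (q.1, i, q.2.2)) fun _ _ => polarization_rowsC_X i j _
  · exact spanStable_minorSet_of_rows
      (fun (p : Fin c) (q : Fin a × Fin b × Fin d) => (q.1, q.2.1, p, q.2.2)) _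
      (fun p => p = j) (fun _ => i) fun _ _ => polarization_rowsC_X i j _
  · exact spanStable_minorSet_of_cols
      (fun (p : Fin d) (q : Fin a × Fin b × Fin c) => (q.1, q.2.1, q.2.2, p)) _
      (fun q => q.2.2 = j) (fun q => (q.1, q.2.1, i)) fun _ _ => polarization_rowsC_X i j _
  · exact spanStable_minorSet_of_cols
      (fun (p : Fin a × Fin b) (q : Fin c × Fin d) => (p.1, p.2, q.1, q.2)) _
      (fun q => q.1 = j) (fun q => (i, q.2)) fun _ _ => polarization_rowsC_X i j _
  · exact spanStable_minorSet_of_rows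
      (fun (p : Fin a × Fin c) (q : Fin b × Fin d) => (p.1, q.1, p.2, q.2)) _
      (fun p => p.2 = j) (fun p => (p.1, i)) fun _ _ => polarization_rowsC_X i j _

theorem polarization_rowsD_X {a b c d : ℕ} (i j : Fin d)
    (x : Fin a × Fin b × Fin c × Fin d) :
    polarization (rowsD a b c d) i j (X x : MvPolynomial _ 𝕜)
      = if x.2.2.2 = j then X (x.1, x.2.1, x.2.2.1, i) else 0 :=
  polarization_X (rowsD a b c d) i j x.2.2.2 (x.1, x.2.1, x.2.2.1)

theorem flatteningMinors_spanStable_rowsD (a b c d : ℕ) (i j : Fin d) :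
    SpanStable (polarization (rowsD a b c d) i j) (flatteningMinors 𝕜 a b c d) := by
  refine SpanStable.union (SpanStable.union (SpanStable.union (SpanStable.union
    (SpanStable.union ?_ ?_) ?_) ?_) ?_) ?_
  · exact spanStable_minorSet_of_cols
      (fun (p : Fin a) (q : Fin b × Fin c × Fin d) => (p, q)) _
      (fun q => q.2.2 = j) (fun q => (q.1, q.2.1, i)) fun _ _ => polarization_rowsD_X i j _
  · exact spanStable_minorSet_of_cols
      (fun (p : Fin b) (q : Fin a × Fin c × Fin d) => (q.1, p, q.2.1, q.2.2)) _
      (fun q => q.2.2 = j) (fun q => (q.1, q.2.1, i)) fun _ _ => polarization_rowsD_X i j _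
  · exact spanStable_minorSet_of_cols
      (fun (p : Fin c) (q : Fin a × Fin b × Fin d) => (q.1, q.2.1, p, q.2.2)) _
      (fun q => q.2.2 = j) (fun q => (q.1, q.2.1, i)) fun _ _ => polarization_rowsD_X i j _
  · exact spanStable_minorSet_of_rows
      (fun (p : Fin d) (q : Fin a × Fin b × Fin c) => (q.1, q.2.1, q.2.2, p)) _
      (fun p => p = j) (fun _ => i) fun _ _ => polarization_rowsD_X i j _
  · exact spanStable_minorSet_of_cols
      (fun (p : Fin a × Fin b) (q : Fin c × Fin d) => (p.1, p.2, q.1, q.2)) _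
      (fun q => q.2 = j) (fun q => (q.1, i)) fun _ _ => polarization_rowsD_X i j _
  · exact spanStable_minorSet_of_cols
      (fun (p : Fin a × Fin c) (q : Fin b × Fin d) => (p.1, q.1, p.2, q.2)) _
      (fun q => q.2 = j) (fun q => (q.1, i)) fun _ _ => polarization_rowsD_X i j _

theorem mem_secantIdeal {a b c d r : ℕ} {f : MvPolynomial (Fin a × Fin b × Fin c × Fin d) 𝕜} :
    f ∈ secantIdeal 𝕜 a b c d r ↔ ∀ T, RankLE r T → eval T f = 0 := by
  simp [secantIdeal, RingHom.mem_ker]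

/-- Substitution of the generic sum of two decomposable tensors. -/
noncomputable def genericRankTwo (𝕜 : Type) [Field 𝕜] (a b c d : ℕ) :
    MvPolynomial (Fin a × Fin b × Fin c × Fin d) 𝕜 →ₐ[𝕜]
      MvPolynomial ((Fin a ⊕ Fin b ⊕ Fin c ⊕ Fin d) × Fin 2) 𝕜 :=
  aeval fun x => ∑ s : Fin 2, X (.inl x.1, s) * X (.inr (.inl x.2.1), s) *
    X (.inr (.inr (.inl x.2.2.1)), s) * X (.inr (.inr (.inr x.2.2.2)), s)

theorem mem_secantIdeal_two_iff [Infinite 𝕜] {a b c d : ℕ}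
    {f : MvPolynomial (Fin a × Fin b × Fin c × Fin d) 𝕜} :
    f ∈ secantIdeal 𝕜 a b c d 2 ↔ genericRankTwo 𝕜 a b c d f = 0 := by
  have key : ∀ y, eval y (genericRankTwo 𝕜 a b c d f) = eval (fun x => ∑ s : Fin 2,
      y (.inl x.1, s) * y (.inr (.inl x.2.1), s) *
      y (.inr (.inr (.inl x.2.2.1)), s) * y (.inr (.inr (.inr x.2.2.2)), s)) f := by
    intro y
    rw [← coe_aeval_eq_eval, ← coe_aeval_eq_eval, RingHom.coe_coe, RingHom.coe_coe,
      ← AlgHom.comp_apply]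
    refine DFunLike.congr_fun (algHom_ext fun x => ?_) f
    simp [genericRankTwo]
  rw [mem_secantIdeal]
  constructor
  · intro h
    refine MvPolynomial.funext fun y => ?_
    rw [key, map_zero]
    exact h _ ⟨fun s i => y (.inl i, s), fun s i => y (.inr (.inl i), s),
      fun s i => y (.inr (.inr (.inl i)), s), fun s i => y (.inr (.inr (.inr i)), s),
      fun x => rfl⟩
  · rintro h T ⟨u, v, w, z, hT⟩
    have h1 := key (fun y => Sum.elim (u y.2) (Sum.elim (v y.2) (Sum.elim (w y.2) (z y.2))) y.1)
    rw [h, map_zero] at h1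
    rw [h1, funext hT]
    rfl

theorem polarization_mem_secantIdeal_of_comm [Infinite 𝕜] {a b c d : ℕ}
    (D : Derivation 𝕜 (MvPolynomial (Fin a × Fin b × Fin c × Fin d) 𝕜)
      (MvPolynomial (Fin a × Fin b × Fin c × Fin d) 𝕜))
    (i j : Fin a ⊕ Fin b ⊕ Fin c ⊕ Fin d)
    (h : ∀ x, genericRankTwo 𝕜 a b c d (D (X x))
      = polarization (Equiv.refl _) i j (genericRankTwo 𝕜 a b c d (X x)))
    {f : MvPolynomial (Fin a × Fin b × Fin c × Fin d) 𝕜} (hf : f ∈ secantIdeal 𝕜 a b c d 2) :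
    D f ∈ secantIdeal 𝕜 a b c d 2 := by
  rw [mem_secantIdeal_two_iff] at hf ⊢
  rw [algHom_comp_derivation _ _ _ h, hf, map_zero]

theorem polarization_refl_X {ι E : Type*} [DecidableEq ι] [Fintype E] (i j : ι) (x : ι × E) :
    polarization (Equiv.refl (ι × E)) i j (X x : MvPolynomial (ι × E) 𝕜)
      = if x.1 = j then X (i, x.2) else 0 :=
  polarization_X (Equiv.refl _) i j x.1 x.2

variable [Infinite 𝕜] {a b c d : ℕ} {f : MvPolynomial (Fin a × Fin b × Fin c × Fin d) 𝕜}

theorem polarization_rowsA_mem_secantIdeal (hf : f ∈ secantIdeal 𝕜 a b c d 2) (i j : Fin a) :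
    polarization (rowsA a b c d) i j f ∈ secantIdeal 𝕜 a b c d 2 := by
  refine polarization_mem_secantIdeal_of_comm _ (.inl i) (.inl j) (fun x => ?_) hf
  rw [polarization_rowsA_X]
  by_cases hj : x.1 = j <;>
    simp [hj, genericRankTwo, polarization_refl_X, Derivation.leibniz]
  ring

theorem polarization_rowsB_mem_secantIdeal (hf : f ∈ secantIdeal 𝕜 a b c d 2) (i j : Fin b) :
    polarization (rowsB a b c d) i j f ∈ secantIdeal 𝕜 a b c d 2 := by
  refine polarization_mem_secantIdeal_of_comm _ (.inr (.inl i)) (.inr (.inl j))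
    (fun x => ?_) hf
  rw [polarization_rowsB_X]
  by_cases hj : x.2.1 = j <;>
    simp [hj, genericRankTwo, polarization_refl_X, Derivation.leibniz]
  ring

theorem polarization_rowsC_mem_secantIdeal (hf : f ∈ secantIdeal 𝕜 a b c d 2) (i j : Fin c) :
    polarization (rowsC a b c d) i j f ∈ secantIdeal 𝕜 a b c d 2 := by
  refine polarization_mem_secantIdeal_of_comm _ (.inr (.inr (.inl i))) (.inr (.inr (.inl j)))
    (fun x => ?_) hf
  rw [polarization_rowsC_X]
  by_cases hj : x.2.2.1 = j <;>
    simp [hj, genericRankTwo, polarization_refl_X, Derivation.leibniz]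
  ring

theorem polarization_rowsD_mem_secantIdeal (hf : f ∈ secantIdeal 𝕜 a b c d 2) (i j : Fin d) :
    polarization (rowsD a b c d) i j f ∈ secantIdeal 𝕜 a b c d 2 := by
  refine polarization_mem_secantIdeal_of_comm _ (.inr (.inr (.inr i))) (.inr (.inr (.inr j)))
    (fun x => ?_) hf
  rw [polarization_rowsD_X]
  by_cases hj : x.2.2.2 = j <;>
    simp [hj, genericRankTwo, polarization_refl_X, Derivation.leibniz]

end Secant

section Reduction

variable {𝕜 : Type} [Field 𝕜] {a b c d : ℕ}

/-- Variables of a `2 × 2 × 2 × 2` subtensor. -/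
def castBlock (ha : 2 ≤ a) (hb : 2 ≤ b) (hc : 2 ≤ c) (hd : 2 ≤ d)
    (x : Fin 2 × Fin 2 × Fin 2 × Fin 2) : Fin a × Fin b × Fin c × Fin d :=
  (Fin.castLE ha x.1, Fin.castLE hb x.2.1, Fin.castLE hc x.2.2.1, Fin.castLE hd x.2.2.2)

theorem RankLE.exists_extend_castBlock (ha : 2 ≤ a) (hb : 2 ≤ b) (hc : 2 ≤ c) (hd : 2 ≤ d)
    {r : ℕ} {T : Fin 2 × Fin 2 × Fin 2 × Fin 2 → 𝕜} (hT : RankLE r T) :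
    ∃ T', RankLE r T' ∧ T' ∘ castBlock ha hb hc hd = T := by
  obtain ⟨u, v, w, z, h⟩ := hT
  have ext : ∀ {n : ℕ} (hn : 2 ≤ n) (y : Fin 2 → 𝕜),
      ∃ y' : Fin n → 𝕜, ∀ i, y' (Fin.castLE hn i) = y i := fun {n} hn y =>
    ⟨fun i => if hi : i.val < 2 then y ⟨i.val, hi⟩ else 0, fun i => dif_pos i.isLt⟩
  choose u' hu using fun s => ext ha (u s)
  choose v' hv using fun s => ext hb (v s)
  choose w' hw using fun s => ext hc (w s)
  choose z' hz using fun s => ext hd (z s)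
  refine ⟨_, ⟨u', v', w', z', fun x => rfl⟩, funext fun x => ?_⟩
  simp [castBlock, hu, hv, hw, hz, h]

theorem mem_secantIdeal_of_rename_mem (ha : 2 ≤ a) (hb : 2 ≤ b) (hc : 2 ≤ c) (hd : 2 ≤ d)
    {r : ℕ} {g : MvPolynomial (Fin 2 × Fin 2 × Fin 2 × Fin 2) 𝕜}
    (hg : rename (castBlock ha hb hc hd) g ∈ secantIdeal 𝕜 a b c d r) :
    g ∈ secantIdeal 𝕜 2 2 2 2 r := by
  rw [mem_secantIdeal] at hg ⊢
  intro T hT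
  obtain ⟨T', hT', h⟩ := hT.exists_extend_castBlock ha hb hc hd
  rw [← h, ← eval_rename]
  exact hg T' hT'

theorem rename_mem_span_flatteningMinors (ha : 2 ≤ a) (hb : 2 ≤ b) (hc : 2 ≤ c) (hd : 2 ≤ d)
    {g : MvPolynomial (Fin 2 × Fin 2 × Fin 2 × Fin 2) 𝕜}
    (hg : g ∈ Ideal.span (minorsAB_CD 𝕜 2 2 2 2 ∪ minorsAC_BD 𝕜 2 2 2 2)) :
    rename (castBlock ha hb hc hd) g ∈ Ideal.span (flatteningMinors 𝕜 a b c d) := by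
  suffices H : Ideal.span (minorsAB_CD 𝕜 2 2 2 2 ∪ minorsAC_BD 𝕜 2 2 2 2) ≤
      (Ideal.span (flatteningMinors 𝕜 a b c d)).comap (rename (castBlock ha hb hc hd)) from H hg
  have hdet : ∀ m : Fin 3 → Fin 3 → Fin 2 × Fin 2 × Fin 2 × Fin 2,
      rename (castBlock ha hb hc hd)
        (Matrix.of fun i j => (X (m i j) : MvPolynomial _ 𝕜)).det
      = (Matrix.of fun i j => (X (castBlock ha hb hc hd (m i j)) : MvPolynomial _ 𝕜)).det := by
    intro m
    simp [Matrix.det_fin_three]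
  rw [Ideal.span_le]
  rintro _ (⟨ρ, γ, rfl⟩ | ⟨ρ, γ, rfl⟩)
  · rw [SetLike.mem_coe, Ideal.mem_comap, hdet]
    refine Ideal.subset_span (Or.inl (Or.inr ?_))
    exact ⟨fun i => (Fin.castLE ha (ρ i).1, Fin.castLE hb (ρ i).2),
      fun i => (Fin.castLE hc (γ i).1, Fin.castLE hd (γ i).2), rfl⟩
  · rw [SetLike.mem_coe, Ideal.mem_comap, hdet]
    refine Ideal.subset_span (Or.inr ?_)
    exact ⟨fun i => (Fin.castLE ha (ρ i).1, Fin.castLE hc (ρ i).2),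
      fun i => (Fin.castLE hb (γ i).1, Fin.castLE hd (γ i).2), rfl⟩

theorem polarization_mem_supported {ι E τ : Type*} [DecidableEq ι] [Fintype E] (t : ι × E ≃ τ)
    (i j : ι) (s : Set E) {f : MvPolynomial τ 𝕜}
    (hf : f ∈ supported 𝕜 {x | (t.symm x).2 ∈ s}) :
    polarization t i j f ∈ supported 𝕜 {x | (t.symm x).2 ∈ s} := by
  refine derivation_mem_supported _ (fun x hx => ?_) hf
  have h := polarization_X (𝕜 := 𝕜) t i j (t.symm x).1 (t.symm x).2
  rw [Prod.mk.eta, Equiv.apply_symm_apply] at h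
  rw [h]
  split_ifs
  · exact X_mem_supported.mpr (by simpa using hx)
  · exact Subalgebra.zero_mem _

/-- If the ideal of `σ₂` is generated by minors for binary tensors, then it is for all tensors. -/
theorem secantIdeal_le_span_flatteningMinors [CharZero 𝕜]
    (ha : 2 ≤ a) (hb : 2 ≤ b) (hc : 2 ≤ c) (hd : 2 ≤ d)
    (binary : secantIdeal 𝕜 2 2 2 2 2 ≤
      Ideal.span (minorsAB_CD 𝕜 2 2 2 2 ∪ minorsAC_BD 𝕜 2 2 2 2)) :
    secantIdeal 𝕜 a b c d 2 ≤ Ideal.span (flatteningMinors 𝕜 a b c d) := by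
  have hne : ∀ {n : ℕ} (hn : 2 ≤ n), Fin.castLE hn 0 ≠ Fin.castLE hn 1 := fun hn h => by
    simpa using Fin.castLE_injective hn h
  let I : Submodule 𝕜 (MvPolynomial (Fin a × Fin b × Fin c × Fin d) 𝕜) :=
    (secantIdeal 𝕜 a b c d 2).restrictScalars 𝕜
  let J := Ideal.span (flatteningMinors 𝕜 a b c d)
  let two : (n : ℕ) → 2 ≤ n → Set (Fin n) := fun n hn =>
    {i | i = Fin.castLE hn 0 ∨ i = Fin.castLE hn 1}
  let sA : Set (Fin a × Fin b × Fin c × Fin d) := {x | x.1 ∈ two a ha}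
  let sB : Set (Fin a × Fin b × Fin c × Fin d) := {x | x.1 ∈ two a ha ∧ x.2.1 ∈ two b hb}
  let sC : Set (Fin a × Fin b × Fin c × Fin d) :=
    {x | x.1 ∈ two a ha ∧ x.2.1 ∈ two b hb ∧ x.2.2.1 ∈ two c hc}
  let sD : Set (Fin a × Fin b × Fin c × Fin d) :=
    {x | x.1 ∈ two a ha ∧ x.2.1 ∈ two b hb ∧ x.2.2.1 ∈ two c hc ∧ x.2.2.2 ∈ two d hd}
  let M : Set (Fin a × Fin b × Fin c × Fin d) →
      Submodule 𝕜 (MvPolynomial (Fin a × Fin b × Fin c × Fin d) 𝕜) :=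
    fun s => I ⊓ Subalgebra.toSubmodule (supported 𝕜 s)
  have mem_of_memD : ∀ f ∈ M sD, f ∈ J := by
    rintro f ⟨hf, hf'⟩
    obtain ⟨g, rfl⟩ := exists_rename_eq_of_vars_subset_range f (castBlock ha hb hc hd) (by
      rintro ⟨i, j, k, l⟩ ⟨i', j', k', l'⟩ h
      simpa [castBlock] using h) (by
      rintro ⟨i, j, k, l⟩ hx
      obtain ⟨h1, h2, h3, h4⟩ := mem_supported.mp hf' hx
      have pick : ∀ {n : ℕ} (hn : 2 ≤ n) (i : Fin n), i ∈ two n hn → ∃ i', Fin.castLE hn i' = i :=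
        fun hn i hi => hi.elim (fun h => ⟨0, h.symm⟩) (fun h => ⟨1, h.symm⟩)
      obtain ⟨i', rfl⟩ := pick ha _ h1
      obtain ⟨j', rfl⟩ := pick hb _ h2
      obtain ⟨k', rfl⟩ := pick hc _ h3
      obtain ⟨l', rfl⟩ := pick hd _ h4
      exact ⟨(i', j', k', l'), rfl⟩)
    exact rename_mem_span_flatteningMinors ha hb hc hd
      (binary (mem_secantIdeal_of_rename_mem ha hb hc hd hf))
  have mem_of_memC : ∀ f ∈ M sC, f ∈ J := by
    refine mem_of_forall_two_rows_mem (rowsD a b c d) (hne hd) (M sC)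
      (fun i j f hf => ⟨polarization_rowsD_mem_secantIdeal hf.1 i j,
        polarization_mem_supported (rowsD a b c d) i j
          {y | y.1 ∈ two a ha ∧ y.2.1 ∈ two b hb ∧ y.2.2 ∈ two c hc} hf.2⟩) J
      (fun i j f hf => (flatteningMinors_spanStable_rowsD a b c d i j).apply_mem hf)
      (fun ρ γ => Ideal.subset_span (Or.inl (Or.inl (Or.inr ⟨ρ, γ, rfl⟩)))) ?_
    refine fun f hf hf' => mem_of_memD f ⟨hf.1, mem_supported.mpr fun x hx => ?_⟩
    obtain ⟨h1, h2, h3⟩ := mem_supported.mp hf.2 hx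
    exact ⟨h1, h2, h3, mem_supported.mp hf' hx⟩
  have mem_of_memB : ∀ f ∈ M sB, f ∈ J := by
    refine mem_of_forall_two_rows_mem (rowsC a b c d) (hne hc) (M sB)
      (fun i j f hf => ⟨polarization_rowsC_mem_secantIdeal hf.1 i j,
        polarization_mem_supported (rowsC a b c d) i j
          {y | y.1 ∈ two a ha ∧ y.2.1 ∈ two b hb} hf.2⟩) J
      (fun i j f hf => (flatteningMinors_spanStable_rowsC a b c d i j).apply_mem hf)
      (fun ρ γ => Ideal.subset_span (Or.inl (Or.inl (Or.inl (Or.inr ⟨ρ, γ, rfl⟩))))) ?_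
    refine fun f hf hf' => mem_of_memC f ⟨hf.1, mem_supported.mpr fun x hx => ?_⟩
    obtain ⟨h1, h2⟩ := mem_supported.mp hf.2 hx
    exact ⟨h1, h2, mem_supported.mp hf' hx⟩
  have mem_of_memA : ∀ f ∈ M sA, f ∈ J := by
    refine mem_of_forall_two_rows_mem (rowsB a b c d) (hne hb) (M sA)
      (fun i j f hf => ⟨polarization_rowsB_mem_secantIdeal hf.1 i j,
        polarization_mem_supported (rowsB a b c d) i j {y | y.1 ∈ two a ha} hf.2⟩) J
      (fun i j f hf => (flatteningMinors_spanStable_rowsB a b c d i j).apply_mem hf)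
      (fun ρ γ => Ideal.subset_span (Or.inl (Or.inl (Or.inl (Or.inl (Or.inr ⟨ρ, γ, rfl⟩)))))) ?_
    exact fun f hf hf' => mem_of_memB f ⟨hf.1, mem_supported.mpr fun x hx =>
      ⟨mem_supported.mp hf.2 hx, mem_supported.mp hf' hx⟩⟩
  exact mem_of_forall_two_rows_mem (rowsA a b c d) (hne ha) I
    (fun i j f hf => polarization_rowsA_mem_secantIdeal hf i j) J
    (fun i j f hf => (flatteningMinors_spanStable_rowsA a b c d i j).apply_mem hf)
    (fun ρ γ => Ideal.subset_span (Or.inl (Or.inl (Or.inl (Or.inl (Or.inl ⟨ρ, γ, rfl⟩))))))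
    fun f hf hf' => mem_of_memA f ⟨hf, hf'⟩

end Reduction

section TwoTermParametrization

variable {𝕜 : Type} [Field 𝕜]

/-- Variables `p_I, r_I, q_J, t_J` (in this order) for the entries of four `2 × 2` matrices. -/
abbrev FourMatrices : Type := Fin 4 × Fin 2 × Fin 2

/-- The parametrization `x_{IJ} ↦ p_I q_J + r_I t_J` of `4 × 4` matrices of rank at most two,
whose rows and columns are indexed by `A ⊗ B` and `C ⊗ D` respectively. -/
noncomputable def twoTerm (𝕜 : Type) [Field 𝕜] :
    MvPolynomial (Fin 2 × Fin 2 × Fin 2 × Fin 2) 𝕜 →ₐ[𝕜] MvPolynomial FourMatrices 𝕜 :=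
  aeval fun x => X (0, x.1, x.2.1) * X (2, x.2.2) + X (1, x.1, x.2.1) * X (3, x.2.2)

theorem twoTerm_X (i j k l : Fin 2) :
    twoTerm 𝕜 (X (i, j, k, l)) = X (0, i, j) * X (2, k, l) + X (1, i, j) * X (3, k, l) := by
  simp [twoTerm]

theorem ker_twoTerm_le [CharZero 𝕜] {f : MvPolynomial (Fin 2 × Fin 2 × Fin 2 × Fin 2) 𝕜}
    (hf : twoTerm 𝕜 f = 0) : f ∈ Ideal.span (minorsAB_CD 𝕜 2 2 2 2) := by
  let t : (Fin 2 × Fin 2) × (Fin 2 × Fin 2) ≃ Fin 2 × Fin 2 × Fin 2 × Fin 2 :=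
    Equiv.prodAssoc _ _ _
  have hX : ∀ (I J : Fin 2 × Fin 2) (x : Fin 2 × Fin 2 × Fin 2 × Fin 2),
      polarization t I J (X x : MvPolynomial _ 𝕜)
        = if (x.1, x.2.1) = J then X (I.1, I.2, x.2.2.1, x.2.2.2) else 0 :=
    fun I J x => polarization_X t I J (x.1, x.2.1) x.2.2
  refine mem_of_forall_two_rows_mem t (i₀ := (0, 0)) (i₁ := (0, 1)) (by decide)
    (LinearMap.ker (twoTerm 𝕜).toLinearMap) (fun I J f hf => ?_) _
    (fun I J f hf => SpanStable.apply_mem (spanStable_minorSet_of_rows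
      (fun (p : Fin 2 × Fin 2) (q : Fin 2 × Fin 2) => (p.1, p.2, q.1, q.2)) _
      (fun p => p = J) (fun _ => I) fun _ _ => hX I J _) hf)
    (fun ρ γ => Ideal.subset_span ⟨ρ, γ, rfl⟩) (fun f hf hf' => ?_) f hf
  · let D' : Derivation 𝕜 (MvPolynomial FourMatrices 𝕜) (MvPolynomial FourMatrices 𝕜) :=
      mkDerivation 𝕜 fun v => if v.1 < 2 ∧ v.2 = J then X (v.1, I) else 0
    have := algHom_comp_derivation (twoTerm 𝕜) (polarization t I J) D' (fun x => by
      rw [hX]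
      by_cases hJ : (x.1, x.2.1) = J <;>
        simp [twoTerm, D', hJ, mkDerivation_X, mul_comm]) f
    simp only [LinearMap.mem_ker, AlgHom.toLinearMap_apply] at hf ⊢
    rw [this, hf, map_zero]
  · simp only [LinearMap.mem_ker, AlgHom.toLinearMap_apply] at hf
    let θ : MvPolynomial FourMatrices 𝕜 →ₐ[𝕜] MvPolynomial (Fin 2 × Fin 2 × Fin 2 × Fin 2) 𝕜 :=
      aeval fun v => ![if v.2 = (0, 0) then 1 else 0, if v.2 = (0, 1) then 1 else 0,
        X (0, 0, v.2), X (0, 1, v.2)] v.1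
    have h : (θ.comp (twoTerm 𝕜) : _ →+* _) f = RingHom.id _ f := by
      refine hom_congr_vars (by ext; simp) (fun x hx _ => ?_) rfl
      obtain ⟨i, j, k, l⟩ := x
      rcases mem_supported.mp hf' hx with h | h
      all_goals
        simp only [t, Equiv.prodAssoc_symm_apply, Prod.mk.injEq] at h
        obtain ⟨rfl, rfl⟩ := h
        simp [twoTerm, θ]
    have h0 : f = 0 := by
      rw [← RingHom.id_apply f, ← h]
      simp [hf]
    rw [h0]
    exact Ideal.zero_mem _

end TwoTermParametrization

section StandardMonomials

variable {σ ρ 𝕜 : Type*} [Field 𝕜]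

theorem map_monomial_of_map_X (φ : MvPolynomial σ 𝕜 →ₐ[𝕜] MvPolynomial ρ 𝕜) (e : σ → ρ →₀ ℕ)
    (v : σ → 𝕜) (h : ∀ i, φ (X i) = monomial (e i) (v i)) (m : σ →₀ ℕ) (c : 𝕜) :
    φ (monomial m c)
      = monomial (m.sum fun i n => n • e i) (c * m.prod fun i n => v i ^ n) := by
  rw [monomial_eq, map_mul, ← algebraMap_eq, AlgHom.commutes, map_finsuppProd]
  simp only [map_pow, h, monomial_pow]
  have key : (m.prod fun i n => monomial (n • e i) (v i ^ n))
      = monomial (m.sum fun i n => n • e i) (m.prod fun i n => v i ^ n) := by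
    rw [monomial_finsupp_sum_index, Finsupp.prod, Finsupp.prod, Finsupp.prod, map_prod,
      ← Finset.prod_mul_distrib]
    exact Finset.prod_congr rfl fun i _ => by rw [C_mul_monomial, mul_one]
  rw [key, algebraMap_eq, C_mul_monomial]

/-- The kernel of a substitution by nonzero terms is contained in an ideal `I` as soon as
rewriting modulo `I` reduces all monomials to ones on which the substitution is injective. -/
theorem mem_of_map_eq_zero_of_standard (φ : MvPolynomial σ 𝕜 →ₐ[𝕜] MvPolynomial ρ 𝕜)
    (I : Ideal (MvPolynomial σ 𝕜)) (hI : ∀ f ∈ I, φ f = 0) (e : σ → ρ →₀ ℕ) (v : σ → 𝕜)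
    (hv : ∀ i, v i ≠ 0) (h : ∀ i, φ (X i) = monomial (e i) (v i)) (std : Set (σ →₀ ℕ))
    (hinj : Set.InjOn (fun m : σ →₀ ℕ => m.sum fun i n => n • e i) std) (μ : (σ →₀ ℕ) → ℕ)
    (hred : ∀ m ∉ std, ∃ m' c, μ m' < μ m ∧
      (monomial m 1 - C c * monomial m' 1 : MvPolynomial σ 𝕜) ∈ I)
    {f : MvPolynomial σ 𝕜} (hf : φ f = 0) : f ∈ I := by
  have hspan : ∀ n m, μ m < n → ∃ g ∈ restrictSupport 𝕜 std,
      (monomial m 1 : MvPolynomial σ 𝕜) - g ∈ I := by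
    intro n
    induction n with
    | zero => intro m hm; omega
    | succ n ih =>
      intro m hm
      by_cases hs : m ∈ std
      · exact ⟨monomial m 1, (monomial_mem_restrictSupport _).mpr (Or.inl hs), by simp⟩
      · obtain ⟨m', c, hlt, hmem⟩ := hred m hs
        obtain ⟨g, hg, hg'⟩ := ih m' (by omega)
        refine ⟨c • g, Submodule.smul_mem _ _ hg, ?_⟩
        have := I.add_mem hmem (I.mul_mem_left (C c) hg')
        rw [mul_sub] at this
        simpa [smul_eq_C_mul] using this
  have hall : ∀ f : MvPolynomial σ 𝕜, ∃ g ∈ restrictSupport 𝕜 std, f - g ∈ I := by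
    intro f
    induction f using MvPolynomial.induction_on' with
    | monomial m c =>
      obtain ⟨g, hg, hg'⟩ := hspan (μ m + 1) m (by omega)
      refine ⟨c • g, Submodule.smul_mem _ _ hg, ?_⟩
      have := I.mul_mem_left (C c) hg'
      rwa [mul_sub, C_mul_monomial, mul_one, ← smul_eq_C_mul] at this
    | add p q hp hq =>
      obtain ⟨g, hg, hg'⟩ := hp
      obtain ⟨g', hg2, hg2'⟩ := hq
      refine ⟨g + g', Submodule.add_mem _ hg hg2, ?_⟩
      have := I.add_mem hg' hg2'
      convert this using 1
      ring
  obtain ⟨g, hg, hg'⟩ := hall f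
  have hφg : φ g = 0 := by
    have := hI _ hg'
    rw [map_sub, hf, zero_sub, neg_eq_zero] at this
    exact this
  have hg0 : g = 0 := by
    classical
    rw [mem_restrictSupport_iff] at hg
    rw [← MvPolynomial.support_eq_empty, Finset.eq_empty_iff_forall_notMem]
    intro m hm
    have h1 := congrArg (coeff (m.sum fun i n => n • e i)) hφg
    rw [g.as_sum, map_sum, coeff_sum, Finset.sum_eq_single m] at h1
    · rw [map_monomial_of_map_X φ e v h, coeff_monomial, if_pos rfl, coeff_zero,
        mul_eq_zero] at h1
      rcases h1 with h1 | h1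
      · exact (mem_support_iff.mp hm) h1
      · exact Finset.prod_ne_zero_iff.mpr (fun i _ => pow_ne_zero _ (hv i)) h1
    · intro m' hm' hne
      rw [map_monomial_of_map_X φ e v h, coeff_monomial, if_neg]
      exact fun heq => hne (hinj (hg hm') (hg hm) heq)
    · exact fun hn => absurd hm hn
  rw [hg0, sub_zero] at hg'
  exact hg'

/-- A binomial relation lowers the weight of monomials divisible by its leading monomial. -/
theorem exists_reduction (I : Ideal (MvPolynomial σ 𝕜)) (w : σ → ℕ) {a b a' b' : σ} {c : 𝕜}
    (hab : a ≠ b) (hI : (X a * X b - C c * (X a' * X b') : MvPolynomial σ 𝕜) ∈ I)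
    (hw : w a' + w b' < w a + w b) {m : σ →₀ ℕ} (ha : m a ≠ 0) (hb : m b ≠ 0) :
    ∃ m' c, Finsupp.weight w m' < Finsupp.weight w m ∧
      (monomial m 1 - C c * monomial m' 1 : MvPolynomial σ 𝕜) ∈ I := by
  classical
  obtain ⟨m₀, rfl⟩ : ∃ m₀, m = m₀ + (Finsupp.single a 1 + Finsupp.single b 1) := by
    refine ⟨m - (Finsupp.single a 1 + Finsupp.single b 1), (tsub_add_cancel_of_le ?_).symm⟩
    intro i
    rw [Finsupp.add_apply, Finsupp.single_apply, Finsupp.single_apply]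
    split_ifs with h1 h2 h2
    · exact absurd (h1.trans h2.symm) hab
    · subst h1; omega
    · subst h2; omega
    · omega
  refine ⟨m₀ + (Finsupp.single a' 1 + Finsupp.single b' 1), c, ?_, ?_⟩
  · simp only [map_add, Finsupp.weight_single, one_smul]
    omega
  · have := I.mul_mem_left (monomial m₀ 1) hI
    convert this using 1
    simp only [mul_sub, X, monomial_mul, mul_one]
    congr 1
    rw [mul_left_comm, monomial_mul, one_mul]

end StandardMonomials

section SegreBlocks

variable {𝕜 : Type} [Field 𝕜]

/-- Determinant of the `s`-th `2 × 2` matrix. -/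
noncomputable def blockDet (𝕜 : Type) [Field 𝕜] (s : Fin 4) : MvPolynomial FourMatrices 𝕜 :=
  X (s, 0, 0) * X (s, 1, 1) - X (s, 0, 1) * X (s, 1, 0)

/-- Substitution of four rank one `2 × 2` matrices. -/
noncomputable def rankOneBlocks (𝕜 : Type) [Field 𝕜] :
    MvPolynomial FourMatrices 𝕜 →ₐ[𝕜] MvPolynomial (Fin 4 × Fin 2 × Fin 2) 𝕜 :=
  aeval fun v => X (v.1, 0, v.2.1) * X (v.1, 1, v.2.2)

theorem mem_span_blockDet_of_rankOneBlocks_eq_zero {f : MvPolynomial FourMatrices 𝕜}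
    (hf : rankOneBlocks 𝕜 f = 0) : f ∈ Ideal.span (Set.range (blockDet 𝕜)) := by
  refine mem_of_map_eq_zero_of_standard (rankOneBlocks 𝕜) _ ?_
    (fun v => Finsupp.single (v.1, 0, v.2.1) 1 + Finsupp.single (v.1, 1, v.2.2) 1) (fun _ => 1)
    (fun _ => one_ne_zero) ?_ {m | ∀ s, m (s, 0, 0) = 0 ∨ m (s, 1, 1) = 0} ?_
    (Finsupp.weight fun v => if v.2.1 = v.2.2 then 1 else 0) ?_ hf
  · intro g hg
    have : Ideal.span (Set.range (blockDet 𝕜)) ≤ RingHom.ker (rankOneBlocks 𝕜) := by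
      rw [Ideal.span_le]
      rintro _ ⟨s, rfl⟩
      simp only [SetLike.mem_coe, RingHom.mem_ker, rankOneBlocks, blockDet, map_sub, map_mul,
        aeval_X]
      ring
    exact this hg
  · intro v
    rw [rankOneBlocks, aeval_X]
    simp only [X, monomial_mul, mul_one]
  · intro m hm m' hm' heq
    have key : ∀ (m : FourMatrices →₀ ℕ) (s : Fin 4) (i j : Fin 2), (m.sum fun v n => n •
        (Finsupp.single (v.1, (0 : Fin 2), v.2.1) 1 + Finsupp.single (v.1, (1 : Fin 2), v.2.2) 1 :
          (Fin 4 × Fin 2 × Fin 2) →₀ ℕ)) (s, j, i)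
        = if j = 0 then m (s, i, 0) + m (s, i, 1) else m (s, 0, i) + m (s, 1, i) := by
      intro m s i j
      rw [Finsupp.sum_fintype _ _ (by simp), Finsupp.finsetSum_apply]
      simp only [Fintype.sum_prod_type, Finsupp.smul_apply, Finsupp.add_apply,
        Finsupp.single_apply, Prod.mk.injEq]
      fin_cases j <;> fin_cases s <;> fin_cases i <;>
        simp [Fin.sum_univ_two]
    ext ⟨s, i, j⟩
    have h1 := hm s
    have h2 := hm' s
    have k1 := (key m s 0 0).symm.trans ((DFunLike.congr_fun heq _).trans (key m' s 0 0))
    have k2 := (key m s 1 0).symm.trans ((DFunLike.congr_fun heq _).trans (key m' s 1 0))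
    have k3 := (key m s 0 1).symm.trans ((DFunLike.congr_fun heq _).trans (key m' s 0 1))
    have k4 := (key m s 1 1).symm.trans ((DFunLike.congr_fun heq _).trans (key m' s 1 1))
    simp only [if_true, one_ne_zero, if_false] at k1 k2 k3 k4
    fin_cases i <;> fin_cases j <;> simp only [Fin.zero_eta, Fin.mk_one] <;> omega
  · intro m hm
    simp only [Set.mem_ofPred_eq, not_forall, not_or] at hm
    obtain ⟨s, h0, h1⟩ := hm
    refine exists_reduction _ _ (a := (s, 0, 0)) (b := (s, 1, 1)) (a' := (s, 0, 1))
      (b' := (s, 1, 0)) (c := 1) (by simp) ?_ (by simp) h0 h1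
    rw [C_1, one_mul]
    exact Ideal.subset_span ⟨s, rfl⟩

end SegreBlocks

section Pencils

variable {𝕜 : Type} [Field 𝕜]

/-- The invariants `det p`, `-⟨p, r⟩`, `det r`, `det q`, `-⟨q, t⟩`, `det t` of four `2 × 2`
matrices. -/
noncomputable def quadraticInvariant (𝕜 : Type) [Field 𝕜] (k : Fin 6) :
    MvPolynomial FourMatrices 𝕜 :=
  ![X (0, 0, 0) * X (0, 1, 1) - X (0, 0, 1) * X (0, 1, 0),
    X (0, 0, 1) * X (1, 1, 0) + X (0, 1, 0) * X (1, 0, 1) - X (0, 0, 0) * X (1, 1, 1)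
      - X (0, 1, 1) * X (1, 0, 0),
    X (1, 0, 0) * X (1, 1, 1) - X (1, 0, 1) * X (1, 1, 0),
    X (2, 0, 0) * X (2, 1, 1) - X (2, 0, 1) * X (2, 1, 0),
    X (2, 0, 1) * X (3, 1, 0) + X (2, 1, 0) * X (3, 0, 1) - X (2, 0, 0) * X (3, 1, 1)
      - X (2, 1, 1) * X (3, 0, 0),
    X (3, 0, 0) * X (3, 1, 1) - X (3, 0, 1) * X (3, 1, 0)] k

/-- The determinants of `αp + r`, `γp + r`, `q - γt`, `αt - q` in terms of the quadratic
invariants. -/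
noncomputable def pencilDet (α γ : 𝕜) (s : Fin 4) : MvPolynomial (Fin 6) 𝕜 :=
  ![C (α ^ 2) * X 0 - C α * X 1 + X 2, C (γ ^ 2) * X 0 - C γ * X 1 + X 2,
    X 3 + C γ * X 4 + C (γ ^ 2) * X 5, X 3 + C α * X 4 + C (α ^ 2) * X 5] s

theorem twoTerm_mem_span_pencilDet [Infinite 𝕜]
    {f : MvPolynomial (Fin 2 × Fin 2 × Fin 2 × Fin 2) 𝕜} (hf : f ∈ secantIdeal 𝕜 2 2 2 2 2)
    {α γ : 𝕜} (hαγ : α ≠ γ) :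
    twoTerm 𝕜 f ∈
      Ideal.span (Set.range fun s => aeval (quadraticInvariant 𝕜) (pencilDet α γ s)) := by
  have hδ : α - γ ≠ 0 := sub_ne_zero.mpr hαγ
  let δ : 𝕜 := (α - γ)⁻¹
  let θ' : MvPolynomial FourMatrices 𝕜 →ₐ[𝕜] MvPolynomial FourMatrices 𝕜 :=
    aeval fun v => ![C δ * (X (0, v.2) - X (1, v.2)),
      C δ * (C α * X (1, v.2) - C γ * X (0, v.2)),
      C δ * (C α * X (2, v.2) + C γ * X (3, v.2)), C δ * (X (2, v.2) + X (3, v.2))] v.1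
  let θ : MvPolynomial FourMatrices 𝕜 →ₐ[𝕜] MvPolynomial FourMatrices 𝕜 :=
    aeval fun v => ![C α * X (0, v.2) + X (1, v.2), C γ * X (0, v.2) + X (1, v.2),
      X (2, v.2) - C γ * X (3, v.2), C α * X (3, v.2) - X (2, v.2)] v.1
  have hC : (C δ * (C α - C γ) : MvPolynomial FourMatrices 𝕜) = 1 := by
    rw [← C_sub, ← C_mul, ← C_1]
    congr 1
    exact inv_mul_cancel₀ hδ
  have hθ : θ.comp θ' = AlgHom.id 𝕜 _ := by
    refine algHom_ext fun v => ?_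
    obtain ⟨s, v⟩ := v
    fin_cases s <;> simp [θ', θ]
    · linear_combination X (0, v) * hC
    · linear_combination X (1, v) * hC
    · linear_combination X (2, v) * hC
    · linear_combination X (3, v) * hC
  have hker : rankOneBlocks 𝕜 (θ' (twoTerm 𝕜 f)) = 0 := by
    refine MvPolynomial.funext fun y => ?_
    rw [map_zero]
    have hcomp : eval y (rankOneBlocks 𝕜 (θ' (twoTerm 𝕜 f))) = eval (fun x => ∑ s : Fin 2,
        ![δ * y (0, 0, x.1), δ * y (1, 0, x.1)] s * ![y (0, 1, x.2.1), y (1, 1, x.2.1)] s *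
          ![y (2, 0, x.2.2.1), y (3, 0, x.2.2.1)] s *
          ![y (2, 1, x.2.2.2), y (3, 1, x.2.2.2)] s) f := by
      rw [← coe_aeval_eq_eval, ← coe_aeval_eq_eval, RingHom.coe_coe, RingHom.coe_coe,
        ← AlgHom.comp_apply, ← AlgHom.comp_apply, ← AlgHom.comp_apply]
      refine DFunLike.congr_fun (algHom_ext fun x => ?_) f
      obtain ⟨i, j, k, l⟩ := x
      simp [twoTerm, θ', rankOneBlocks]
      have hδ' : δ * (α - γ) = 1 := inv_mul_cancel₀ hδ
      linear_combination (δ * (y (0, 0, i) * y (0, 1, j) * y (2, 0, k) * y (2, 1, l)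
        + y (1, 0, i) * y (1, 1, j) * y (3, 0, k) * y (3, 1, l))) * hδ'
    rw [hcomp]
    exact mem_secantIdeal.mp hf _ ⟨fun s i => ![δ * y (0, 0, i), δ * y (1, 0, i)] s,
      fun s j => ![y (0, 1, j), y (1, 1, j)] s, fun s k => ![y (2, 0, k), y (3, 0, k)] s,
      fun s l => ![y (2, 1, l), y (3, 1, l)] s, fun x => rfl⟩
  have hmem := Ideal.mem_map_of_mem θ (mem_span_blockDet_of_rankOneBlocks_eq_zero hker)
  rw [← AlgHom.comp_apply, hθ, AlgHom.id_apply, Ideal.map_span, ← Set.range_comp] at hmem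
  convert hmem using 4 with s
  fin_cases s <;> simp [pencilDet, quadraticInvariant, blockDet, θ] <;> ring

end Pencils

section LeadingMonomials

variable {σ ρ κ 𝕜 : Type*} [Field 𝕜]

/-- If each `g i` is the monomial `e i` plus terms of lower weight, then substituting `g` in a
monomial yields the product of the corresponding leading monomials plus terms of lower weight. -/
theorem aeval_monomial_sub_mem_restrictSupport (w : σ → ℕ) (g : ρ → MvPolynomial σ 𝕜)
    (e : ρ → σ →₀ ℕ)
    (h : ∀ i, g i - monomial (e i) 1 ∈
      restrictSupport 𝕜 {m | Finsupp.weight w m < Finsupp.weight w (e i)}) (n : ρ →₀ ℕ) :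
    aeval g (monomial n (1 : 𝕜)) - monomial (Finsupp.weight e n) 1 ∈
      restrictSupport 𝕜 {m | Finsupp.weight w m < Finsupp.weight w (Finsupp.weight e n)} := by
  have hmul : ∀ (m m' : σ →₀ ℕ) (p q : MvPolynomial σ 𝕜),
      p - monomial m 1 ∈ restrictSupport 𝕜 {l | Finsupp.weight w l < Finsupp.weight w m} →
      q - monomial m' 1 ∈ restrictSupport 𝕜 {l | Finsupp.weight w l < Finsupp.weight w m'} →
      p * q - monomial (m + m') 1 ∈
        restrictSupport 𝕜 {l | Finsupp.weight w l < Finsupp.weight w (m + m')} := by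
    intro m m' p q hp hq
    have hm : ∀ m : σ →₀ ℕ, (monomial m 1 : MvPolynomial σ 𝕜) ∈ restrictSupport 𝕜 {m} :=
      fun m => (monomial_mem_restrictSupport _).mpr (Or.inl rfl)
    have key : p * q - monomial (m + m') 1 = (p - monomial m 1) * (q - monomial m' 1)
        + (p - monomial m 1) * monomial m' 1 + monomial m 1 * (q - monomial m' 1) := by
      rw [show (monomial (m + m') 1 : MvPolynomial σ 𝕜) = monomial m 1 * monomial m' 1 by
        rw [monomial_mul, one_mul]]
      ring
    rw [key]
    refine add_mem (add_mem ?_ ?_) ?_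
    · refine restrictSupport_mono _ ?_
        (restrictSupport_add (R := 𝕜) _ _ ▸ Submodule.mul_mem_mul hp hq)
      rintro _ ⟨l, hl, l', hl', rfl⟩
      simp only [Set.mem_ofPred_eq, map_add] at hl hl' ⊢
      omega
    · refine restrictSupport_mono _ ?_
        (restrictSupport_add (R := 𝕜) _ _ ▸ Submodule.mul_mem_mul hp (hm m'))
      rintro _ ⟨l, hl, l', rfl, rfl⟩
      simp only [Set.mem_ofPred_eq, map_add] at hl ⊢
      omega
    · refine restrictSupport_mono _ ?_
        (restrictSupport_add (R := 𝕜) _ _ ▸ Submodule.mul_mem_mul (hm m) hq)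
      rintro _ ⟨l, rfl, l', hl', rfl⟩
      simp only [Set.mem_ofPred_eq, map_add] at hl' ⊢
      omega
  have hadd : ∀ n n' : ρ →₀ ℕ,
      (monomial (n + n') 1 : MvPolynomial ρ 𝕜) = monomial n 1 * monomial n' 1 := fun n n' => by
    rw [monomial_mul, one_mul]
  induction n using Finsupp.induction_linear with
  | zero => simp
  | add n n' hn hn' =>
    rw [hadd, map_mul, map_add]
    exact hmul _ _ _ _ hn hn'
  | single i k =>
    induction k with
    | zero => simp
    | succ k ih =>
      rw [Finsupp.single_add, hadd, map_mul, map_add]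
      refine hmul _ _ _ _ ih ?_
      simpa [Finsupp.weight_single, ← X.eq_1] using h i

theorem eq_zero_of_aeval_eq_zero_of_leading (w : σ → ℕ) (g : ρ → MvPolynomial σ 𝕜)
    (e : ρ → σ →₀ ℕ)
    (h : ∀ i, g i - monomial (e i) 1 ∈
      restrictSupport 𝕜 {m | Finsupp.weight w m < Finsupp.weight w (e i)}) {std : Set (ρ →₀ ℕ)}
    (hinj : Set.InjOn (Finsupp.weight e) std) {f : MvPolynomial ρ 𝕜}
    (hf : f ∈ restrictSupport 𝕜 std) (hf0 : aeval g f = 0) : f = 0 := by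
  classical
  by_contra hne
  obtain ⟨n, hn, hmax⟩ := Finset.exists_max_image f.support
    (fun n => Finsupp.weight w (Finsupp.weight e n)) (support_nonempty.mpr hne)
  have h1 := congrArg (coeff (Finsupp.weight e n)) hf0
  rw [f.as_sum, map_sum, coeff_sum, coeff_zero] at h1
  have h2 : ∀ n' ∈ f.support, coeff (Finsupp.weight e n) (aeval g (monomial n' (coeff n' f)))
      = if n' = n then coeff n' f else 0 := by
    intro n' hn'
    have h3 : coeff (Finsupp.weight e n)
        (aeval g (monomial n' (1 : 𝕜)) - monomial (Finsupp.weight e n') 1) = 0 := by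
      by_contra h4
      exact absurd (hmax n' hn')
        (not_le.mpr (aeval_monomial_sub_mem_restrictSupport w g e h n' (mem_support_iff.mpr h4)))
    rw [coeff_sub, coeff_monomial, sub_eq_zero] at h3
    rw [← mul_one (coeff n' f), ← smul_eq_mul, ← smul_monomial, map_smul, coeff_smul, h3,
      smul_eq_mul, smul_eq_mul]
    by_cases heq : n' = n
    · simp [heq]
    · rw [if_neg heq, if_neg fun h4 => heq (hinj (hf hn') (hf hn) h4), mul_zero]
  rw [Finset.sum_congr rfl h2, Finset.sum_ite_eq' f.support n, if_pos hn] at h1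
  exact mem_support_iff.mp hn h1

theorem exists_aeval_eq_of_leading (w : σ → ℕ) (g : ρ → MvPolynomial σ 𝕜) (e : ρ → σ →₀ ℕ)
    (h : ∀ i, g i - monomial (e i) 1 ∈
      restrictSupport 𝕜 {m | Finsupp.weight w m < Finsupp.weight w (e i)}) {std : Set (ρ →₀ ℕ)}
    (hsurj : ∀ m, ∃ n ∈ std, Finsupp.weight e n = m) (p : MvPolynomial σ 𝕜) :
    ∃ f ∈ restrictSupport 𝕜 std, aeval g f = p := by
  suffices hmon : ∀ N, restrictSupport 𝕜 {m | Finsupp.weight w m < N} ≤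
      (restrictSupport 𝕜 std).map (aeval g).toLinearMap by
    refine hmon (p.support.sup (Finsupp.weight w) + 1)
      ((mem_restrictSupport_iff (R := 𝕜)).mpr fun m hm => ?_)
    exact Nat.lt_succ_of_le (Finset.le_sup (f := Finsupp.weight w) hm)
  intro N
  induction N with
  | zero =>
    rw [restrictSupport_eq_span, Submodule.span_le]
    rintro _ ⟨m, hm, rfl⟩
    exact absurd hm (Nat.not_lt_zero _)
  | succ N ih =>
    rw [restrictSupport_eq_span, Submodule.span_le]
    rintro _ ⟨m, hm, rfl⟩
    obtain ⟨n, hn, rfl⟩ := hsurj m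
    have h1 := ih (restrictSupport_mono 𝕜 (fun m' hm' =>
      (lt_of_lt_of_le (show _ < _ from hm') (Nat.le_of_lt_succ hm) : _ < N))
      (aeval_monomial_sub_mem_restrictSupport w g e h n))
    have h2 : aeval g (monomial n (1 : 𝕜)) ∈ (restrictSupport 𝕜 std).map (aeval g).toLinearMap :=
      ⟨_, (monomial_mem_restrictSupport _).mpr (Or.inl hn), rfl⟩
    simpa using sub_mem h2 h1

/-- Monomials in `σ ⊕ κ` that are not divisible by any product of the variables `a k`, `b k`. -/
def standardMonomials (a b : κ → σ) : Set (σ ⊕ κ →₀ ℕ) :=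
  {n | ∀ k, n (Sum.inl (a k)) = 0 ∨ n (Sum.inl (b k)) = 0}

theorem mem_span_rename_of_aeval_mem [Finite κ] (w : σ → ℕ) (G : κ → MvPolynomial σ 𝕜)
    (a b : κ → σ) (hab : Function.Injective (Sum.elim a b))
    (hG : ∀ k, G k - X (a k) * X (b k) ∈
      restrictSupport 𝕜 {m | Finsupp.weight w m < w (a k) + w (b k)})
    (h : MvPolynomial σ 𝕜) :
    ∃ H : MvPolynomial (σ ⊕ κ) 𝕜, aeval (Sum.elim X G) H = h ∧
      ∀ p : Fin 4 → MvPolynomial κ 𝕜, h ∈ Ideal.span (Set.range fun s => aeval G (p s)) →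
        H ∈ Ideal.span (Set.range fun s => rename Sum.inr (p s)) := by
  classical
  let e : σ ⊕ κ → σ →₀ ℕ := Sum.elim (fun i => Finsupp.single i 1)
    fun k => Finsupp.single (a k) 1 + Finsupp.single (b k) 1
  have he : ∀ i, (Sum.elim X G i : MvPolynomial σ 𝕜) - monomial (e i) 1 ∈
      restrictSupport 𝕜 {m | Finsupp.weight w m < Finsupp.weight w (e i)} := by
    rintro (i | k)
    · simp [e, X]
    · have := hG k
      simpa [e, X, monomial_mul, Finsupp.weight_single] using this
  have hsurj : ∀ N, ∀ m : σ →₀ ℕ, m.degree < N →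
      ∃ n ∈ standardMonomials a b, Finsupp.weight e n = m := by
    intro N
    induction N with
    | zero => intro m hm; omega
    | succ N ih =>
      intro m hm
      by_cases hs : ∀ k, m (a k) = 0 ∨ m (b k) = 0
      · refine ⟨m.mapDomain Sum.inl, fun k => ?_, ?_⟩
        · simpa [Finsupp.mapDomain_apply Sum.inl_injective] using hs k
        · rw [Finsupp.weight_apply, Finsupp.sum_mapDomain_index (by simp)
            fun _ _ _ => add_smul _ _ _]
          simp [e]
      · simp only [not_forall, not_or] at hs
        obtain ⟨k, h0, h1⟩ := hs
        have hne : a k ≠ b k := fun h => by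
          have := @hab (Sum.inl k) (Sum.inr k) h
          simp at this
        obtain ⟨m₀, rfl⟩ : ∃ m₀, m = m₀ + (Finsupp.single (a k) 1 + Finsupp.single (b k) 1) := by
          refine ⟨m - (Finsupp.single (a k) 1 + Finsupp.single (b k) 1),
            (tsub_add_cancel_of_le fun i => ?_).symm⟩
          rw [Finsupp.add_apply, Finsupp.single_apply, Finsupp.single_apply]
          split_ifs with h1 h2 h2
          · exact absurd (h1.trans h2.symm) hne
          · subst h1; omega
          · subst h2; omega
          · omega
        obtain ⟨n, hn, rfl⟩ := ih m₀ (by simp at hm; omega)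
        refine ⟨n + Finsupp.single (Sum.inr k) 1, fun l => ?_, ?_⟩
        · simpa using hn l
        · simp [Finsupp.weight_single, e]
  have hinj : Set.InjOn (Finsupp.weight e) (standardMonomials a b) := by
    have := Fintype.ofFinite κ
    have key : ∀ (n : σ ⊕ κ →₀ ℕ) (i : σ), Finsupp.weight e n i = n (Sum.inl i) +
        ∑ k, n (Sum.inr k) * ((if a k = i then 1 else 0) + if b k = i then 1 else 0) := by
      intro n i
      induction n using Finsupp.induction_linear with
      | zero => simp
      | add n n' hn hn' =>
        rw [map_add, Finsupp.add_apply, hn, hn', Finsupp.add_apply]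
        simp only [Finsupp.add_apply, add_mul, Finset.sum_add_distrib]
        ring
      | single j k =>
        rcases j with j | j
        · simp [Finsupp.weight_single, e, Finsupp.single_apply]
        · simp only [Finsupp.weight_single, e, Finsupp.single_apply, Sum.elim_inr, reduceCtorEq,
            if_false, Sum.inr.injEq, ite_mul, zero_mul, Finset.sum_ite_eq, Finset.mem_univ, if_true,
            Finsupp.smul_apply, Finsupp.add_apply, smul_eq_mul, zero_add]
    have ha : ∀ n k, Finsupp.weight e n (a k) = n (Sum.inl (a k)) + n (Sum.inr k) := by
      intro n k
      rw [key, Finset.sum_eq_single k]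
      · simp [show b k ≠ a k from fun h => by simpa using @hab (Sum.inr k) (Sum.inl k) h]
      · intro l _ hl
        simp [show b l ≠ a k from fun h => by simpa using @hab (Sum.inr l) (Sum.inl k) h,
          show a l ≠ a k from fun h => hl (by simpa using @hab (Sum.inl l) (Sum.inl k) h)]
      · simp
    have hb : ∀ n k, Finsupp.weight e n (b k) = n (Sum.inl (b k)) + n (Sum.inr k) := by
      intro n k
      rw [key, Finset.sum_eq_single k]
      · simp [show a k ≠ b k from fun h => by simpa using @hab (Sum.inl k) (Sum.inr k) h]
      · intro l _ hl
        simp [show a l ≠ b k from fun h => by simpa using @hab (Sum.inl l) (Sum.inr k) h,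
          show b l ≠ b k from fun h => hl (by simpa using @hab (Sum.inr l) (Sum.inr k) h)]
      · simp
    intro n hn n' hn' heq
    have hr : ∀ k, n (Sum.inr k) = n' (Sum.inr k) := by
      intro k
      have h1 := (ha n k).symm.trans ((DFunLike.congr_fun heq _).trans (ha n' k))
      have h2 := (hb n k).symm.trans ((DFunLike.congr_fun heq _).trans (hb n' k))
      have h3 := hn k
      have h4 := hn' k
      omega
    ext (i | k)
    · have h1 := (key n i).symm.trans ((DFunLike.congr_fun heq _).trans (key n' i))
      simp only [hr] at h1
      omega
    · exact hr k
  have hlift : ∀ h : MvPolynomial σ 𝕜, ∃ H ∈ restrictSupport 𝕜 (standardMonomials a b),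
      aeval (Sum.elim X G) H = h :=
    exists_aeval_eq_of_leading w _ e he fun m => hsurj _ m (Nat.lt_succ_self _)
  have hren : ∀ p : MvPolynomial κ 𝕜,
      rename Sum.inr p ∈ restrictSupport 𝕜 {n : σ ⊕ κ →₀ ℕ | ∀ i, n (Sum.inl i) = 0} := by
    intro p
    induction p using MvPolynomial.induction_on' with
    | monomial m c =>
      rw [rename_monomial, monomial_mem_restrictSupport]
      exact Or.inl fun i => Finsupp.mapDomain_of_notMem_range _ _ (by simp)
    | add p q hp hq => rw [map_add]; exact add_mem hp hq
  obtain ⟨H, hH, rfl⟩ := hlift h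
  refine ⟨H, rfl, fun p hp => ?_⟩
  obtain ⟨c, hc⟩ := Ideal.mem_span_range_iff_exists_fun.mp hp
  choose L hL hL' using hlift
  suffices heq : H = ∑ s, L (c s) * rename Sum.inr (p s) by
    rw [heq]
    exact sum_mem fun s _ => Ideal.mul_mem_left _ _ (Ideal.subset_span ⟨s, rfl⟩)
  rw [← sub_eq_zero]
  refine eq_zero_of_aeval_eq_zero_of_leading w _ e he hinj
    (sub_mem hH (sum_mem fun s _ => ?_)) ?_
  · refine restrictSupport_mono _ ?_
      (restrictSupport_add (R := 𝕜) _ _ ▸ Submodule.mul_mem_mul (hL (c s)) (hren (p s)))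
    rintro _ ⟨n, hn, n', hn', rfl⟩ k
    have := hn k
    simp only [Finsupp.add_apply, hn' _, add_zero]
    exact this
  · rw [map_sub, map_sum, ← hc, sub_eq_zero]
    refine Finset.sum_congr rfl fun s _ => ?_
    rw [map_mul, hL', aeval_rename, Sum.elim_comp_inr]

end LeadingMonomials

section PencilRelations

variable {𝕜 : Type} [Field 𝕜]

/-- The common zeros of these quadrics are the values of the quadratic invariants for which the
quadrics `λ ↦ det (λp + r)` and `λ ↦ det (q - λt)` have the same roots. -/
noncomputable def pencilRelation (𝕜 : Type) [Field 𝕜] (s : Fin 3) : MvPolynomial (Fin 6) 𝕜 :=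
  ![X 0 * X 4 + X 1 * X 5, X 0 * X 3 - X 2 * X 5, X 1 * X 3 + X 2 * X 4] s

/-- Parametrization of pairs of proportional quadrics with leading coefficients `λ`, `t`, sum of
roots `σ` and product of roots `π`, keeping further variables `τ`. -/
noncomputable def pencilPoint (τ 𝕜 : Type) [Field 𝕜] :
    MvPolynomial (τ ⊕ Fin 6) 𝕜 →ₐ[𝕜] MvPolynomial (τ ⊕ Fin 4) 𝕜 :=
  aeval (Sum.elim (fun i => X (Sum.inl i))
    ![X (Sum.inr 0), X (Sum.inr 2) * X (Sum.inr 0), X (Sum.inr 3) * X (Sum.inr 0),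
      X (Sum.inr 3) * X (Sum.inr 1), -(X (Sum.inr 2) * X (Sum.inr 1)), X (Sum.inr 1)])

theorem mem_span_pencilRelation_of_pencilPoint_eq_zero {τ : Type} {H : MvPolynomial (τ ⊕ Fin 6) 𝕜}
    (hH : pencilPoint τ 𝕜 H = 0) :
    H ∈ Ideal.span (Set.range fun s => rename Sum.inr (pencilRelation 𝕜 s)) := by
  classical
  let e : τ ⊕ Fin 6 → τ ⊕ Fin 4 →₀ ℕ := Sum.elim (fun i => Finsupp.single (Sum.inl i) 1)
    ![Finsupp.single (Sum.inr 0) 1, Finsupp.single (Sum.inr 2) 1 + Finsupp.single (Sum.inr 0) 1,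
      Finsupp.single (Sum.inr 3) 1 + Finsupp.single (Sum.inr 0) 1,
      Finsupp.single (Sum.inr 3) 1 + Finsupp.single (Sum.inr 1) 1,
      Finsupp.single (Sum.inr 2) 1 + Finsupp.single (Sum.inr 1) 1, Finsupp.single (Sum.inr 1) 1]
  refine mem_of_map_eq_zero_of_standard (pencilPoint τ 𝕜) _ ?_ e
    (Sum.elim (fun _ => 1) ![1, 1, 1, 1, -1, 1]) ?_ ?_
    {m | (m (Sum.inr 0) = 0 ∨ m (Sum.inr 4) = 0) ∧ (m (Sum.inr 0) = 0 ∨ m (Sum.inr 3) = 0) ∧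
      (m (Sum.inr 1) = 0 ∨ m (Sum.inr 3) = 0)} ?_
    (Finsupp.weight (Sum.elim (fun _ => 0) ![2, 1, 0, 0, 0, 0])) ?_ hH
  · intro g hg
    have : Ideal.span (Set.range fun s => rename Sum.inr (pencilRelation 𝕜 s)) ≤
        RingHom.ker (pencilPoint τ 𝕜) := by
      rw [Ideal.span_le]
      rintro _ ⟨s, rfl⟩
      fin_cases s <;> simp [pencilRelation, pencilPoint] <;> ring
    exact this hg
  · rintro (i | k)
    · simp
    · fin_cases k <;> simp
  · rintro (i | k)
    · rw [pencilPoint, aeval_X]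
      rfl
    · rw [pencilPoint, aeval_X]
      fin_cases k <;> simp [e, X, monomial_mul]
  · have key : ∀ (m : τ ⊕ Fin 6 →₀ ℕ),
        (∀ i, (m.sum fun v n => n • e v) (Sum.inl i) = m (Sum.inl i)) ∧
        (m.sum fun v n => n • e v) (Sum.inr 0)
          = m (Sum.inr 0) + m (Sum.inr 1) + m (Sum.inr 2) ∧
        (m.sum fun v n => n • e v) (Sum.inr 1)
          = m (Sum.inr 3) + m (Sum.inr 4) + m (Sum.inr 5) ∧
        (m.sum fun v n => n • e v) (Sum.inr 2) = m (Sum.inr 1) + m (Sum.inr 4) ∧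
        (m.sum fun v n => n • e v) (Sum.inr 3) = m (Sum.inr 2) + m (Sum.inr 3) := by
      intro m
      rw [← Finsupp.weight_apply]
      induction m using Finsupp.induction_linear with
      | zero => simp
      | add m m' hm hm' =>
        obtain ⟨h0, h1, h2, h3, h4⟩ := hm
        obtain ⟨h0', h1', h2', h3', h4'⟩ := hm'
        simp only [map_add, Finsupp.add_apply, h0, h1, h2, h3, h4, h0', h1', h2', h3', h4']
        refine ⟨fun _ => trivial, ?_, ?_, ?_, ?_⟩ <;> ring
      | single v n =>
        rcases v with v | v
        · simp [Finsupp.weight_single, e, Finsupp.single_apply]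
        · fin_cases v <;> simp [Finsupp.weight_single, e]
    intro m hm m' hm' heq
    obtain ⟨h1, h2, h3⟩ := hm
    obtain ⟨h1', h2', h3'⟩ := hm'
    obtain ⟨k0, k1, k2, k3, k4⟩ := key m
    obtain ⟨k0', k1', k2', k3', k4'⟩ := key m'
    simp only [heq] at k0 k1 k2 k3 k4
    rw [k1'] at k1
    rw [k2'] at k2
    rw [k3'] at k3
    rw [k4'] at k4
    ext (i | k)
    · rw [← k0, k0']
    · fin_cases k <;> simp only [Fin.reduceFinMk, Fin.zero_eta, Fin.mk_one] <;> omega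
  · intro m hm
    simp only [Set.mem_ofPred_eq, not_and_or, not_or] at hm
    have hmem : ∀ s, (rename Sum.inr (pencilRelation 𝕜 s) : MvPolynomial (τ ⊕ Fin 6) 𝕜) ∈
        Ideal.span (Set.range fun s => rename Sum.inr (pencilRelation 𝕜 s)) :=
      fun s => Ideal.subset_span ⟨s, rfl⟩
    rcases hm with ⟨h0, h1⟩ | ⟨h0, h1⟩ | ⟨h0, h1⟩
    · refine exists_reduction _ _ (a' := Sum.inr 1) (b' := Sum.inr 5) (c := -1) (by simp) ?_
        (by simp) h0 h1
      convert hmem 0 using 1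
      simp [pencilRelation]
    · refine exists_reduction _ _ (a' := Sum.inr 2) (b' := Sum.inr 5) (c := 1) (by simp) ?_
        (by simp) h0 h1
      convert hmem 1 using 1
      simp [pencilRelation]
    · refine exists_reduction _ _ (a' := Sum.inr 2) (b' := Sum.inr 4) (c := -1) (by simp) ?_
        (by simp) h0 h1
      convert hmem 2 using 1
      simp [pencilRelation]

theorem pencilPoint_eq_zero [CharZero 𝕜] {τ : Type} {H : MvPolynomial (τ ⊕ Fin 6) 𝕜}
    (hH : ∀ α γ : 𝕜, α ≠ γ →
      H ∈ Ideal.span (Set.range fun s => rename Sum.inr (pencilDet α γ s))) :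
    pencilPoint τ 𝕜 H = 0 := by
  classical
  refine MvPolynomial.funext fun y => ?_
  rw [map_zero]
  let P : Polynomial 𝕜 := aeval (fun v => if v = Sum.inr 3 then Polynomial.X else
    Polynomial.C (y v)) (pencilPoint τ 𝕜 H)
  have hP : ∀ z, P.eval z = eval (Function.update y (Sum.inr 3) z) (pencilPoint τ 𝕜 H) := by
    intro z
    rw [← Polynomial.coe_aeval_eq_eval, ← coe_aeval_eq_eval, RingHom.coe_coe]
    show Polynomial.aeval z (aeval _ _) = _
    rw [← AlgHom.comp_apply, comp_aeval]
    congr 2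
    funext v
    by_cases hv : v = Sum.inr 3
    · subst hv; simp
    · simp [hv]
  have hroot : ∀ n : ℕ, P.IsRoot (y (Sum.inr 2) ^ 2 / 4 - ((n : 𝕜) + 1) ^ 2) := by
    intro n
    let α : 𝕜 := y (Sum.inr 2) / 2 + (n + 1)
    let γ : 𝕜 := y (Sum.inr 2) / 2 - (n + 1)
    have hαγ : α ≠ γ := by
      intro h
      have h1 : (2 : 𝕜) * (n + 1) = 0 := by linear_combination h
      exact absurd h1 (mul_ne_zero two_ne_zero (by exact_mod_cast n.succ_ne_zero))
    have hs : y (Sum.inr 2) = α + γ := by simp only [α, γ]; ring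
    have hp : y (Sum.inr 2) ^ 2 / 4 - ((n : 𝕜) + 1) ^ 2 = α * γ := by simp only [α, γ]; ring
    rw [Polynomial.IsRoot, hP, hp]
    have hle : Ideal.span (Set.range fun s => rename Sum.inr (pencilDet α γ s)) ≤
        RingHom.ker ((eval (Function.update y (Sum.inr 3) (α * γ))).comp
          (pencilPoint τ 𝕜 : MvPolynomial (τ ⊕ Fin 6) 𝕜 →+* _)) := by
      rw [Ideal.span_le]
      rintro _ ⟨s, rfl⟩
      fin_cases s <;> simp [pencilDet, pencilPoint, hs] <;> ring
    exact hle (hH α γ hαγ)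
  have hzero : P = 0 := by
    refine Polynomial.eq_zero_of_infinite_isRoot P ?_
    refine (Set.infinite_range_of_injective (f := fun n : ℕ =>
      y (Sum.inr 2) ^ 2 / 4 - ((n : 𝕜) + 1) ^ 2) fun n n' h => ?_).mono ?_
    · have h1 : ((n : 𝕜) + 1) ^ 2 = ((n' : 𝕜) + 1) ^ 2 := by linear_combination -h
      have h2 : (n + 1) ^ 2 = (n' + 1) ^ 2 := by exact_mod_cast h1
      have h3 := Nat.pow_left_injective two_ne_zero h2
      omega
    · rintro _ ⟨n, rfl⟩
      exact hroot n
  have := hP (y (Sum.inr 3))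
  rw [hzero, Polynomial.eval_zero, Function.update_eq_self] at this
  exact this.symm

theorem twoTerm_mem_span_pencilRelation [CharZero 𝕜]
    {f : MvPolynomial (Fin 2 × Fin 2 × Fin 2 × Fin 2) 𝕜} (hf : f ∈ secantIdeal 𝕜 2 2 2 2 2) :
    twoTerm 𝕜 f ∈
      Ideal.span (Set.range fun s => aeval (quadraticInvariant 𝕜) (pencilRelation 𝕜 s)) := by
  let a : Fin 6 → FourMatrices :=
    ![(0, 0, 0), (0, 0, 1), (1, 0, 0), (2, 0, 0), (2, 0, 1), (3, 0, 0)]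
  let b : Fin 6 → FourMatrices :=
    ![(0, 1, 1), (1, 1, 0), (1, 1, 1), (2, 1, 1), (3, 1, 0), (3, 1, 1)]
  let w : FourMatrices → ℕ := fun v => if v.2.1 = v.2.2 then 3 else
    if v ∈ ({(0, 0, 1), (1, 1, 0), (2, 0, 1), (3, 1, 0)} : Finset FourMatrices) then 5 else 0
  obtain ⟨H, hH, hmem⟩ := mem_span_rename_of_aeval_mem w (quadraticInvariant 𝕜) a b (by decide)
    (fun k => by
      have hX : ∀ u v : FourMatrices, (X u * X v : MvPolynomial FourMatrices 𝕜)
          = monomial (Finsupp.single u 1 + Finsupp.single v 1) 1 := by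
        simp [X, monomial_mul]
      have hmon : ∀ (N : ℕ) (u v : FourMatrices), w u + w v < N →
          (X u * X v : MvPolynomial FourMatrices 𝕜) ∈
            restrictSupport 𝕜 {m | Finsupp.weight w m < N} := by
        intro N u v h
        rw [hX, monomial_mem_restrictSupport]
        left
        simpa [Finsupp.weight_single] using h
      have hdet : ∀ (N : ℕ) (s : Fin 4), w (s, 0, 1) + w (s, 1, 0) < N →
          blockDet 𝕜 s - X (s, 0, 0) * X (s, 1, 1) ∈
            restrictSupport 𝕜 {m | Finsupp.weight w m < N} := by
        intro N s h
        rw [blockDet, sub_sub_cancel_left]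
        exact neg_mem (hmon N _ _ h)
      have hpol : ∀ (N : ℕ) (s s' : Fin 4), w (s, 1, 0) + w (s', 0, 1) < N →
          w (s, 0, 0) + w (s', 1, 1) < N → w (s, 1, 1) + w (s', 0, 0) < N →
          X (s, 0, 1) * X (s', 1, 0) + X (s, 1, 0) * X (s', 0, 1) - X (s, 0, 0) * X (s', 1, 1)
            - X (s, 1, 1) * X (s', 0, 0) - X (s, 0, 1) * X (s', 1, 0) ∈
            restrictSupport 𝕜 {m | Finsupp.weight w m < N} := by
        intro N s s' h h' h''
        convert sub_mem (sub_mem (hmon N _ _ h) (hmon N _ _ h')) (hmon N _ _ h'') using 1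
        ring
      fin_cases k
      · exact hdet _ 0 (by decide)
      · exact hpol _ 0 1 (by decide) (by decide) (by decide)
      · exact hdet _ 1 (by decide)
      · exact hdet _ 2 (by decide)
      · exact hpol _ 2 3 (by decide) (by decide) (by decide)
      · exact hdet _ 3 (by decide)) (twoTerm 𝕜 f)
  have h0 := mem_span_pencilRelation_of_pencilPoint_eq_zero (pencilPoint_eq_zero fun α γ hαγ =>
    hmem _ (twoTerm_mem_span_pencilDet hf hαγ))
  have h1 := Ideal.mem_map_of_mem (aeval (Sum.elim X (quadraticInvariant 𝕜))) h0
  rw [hH, Ideal.map_span, ← Set.range_comp] at h1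
  convert h1 using 4 with s
  rw [Function.comp_apply, aeval_rename, Sum.elim_comp_inr]

end PencilRelations

section LinearVectorFields

variable {σ : Type*} [Fintype σ]

/-- The derivation of a polynomial ring that acts on linear forms through an integer matrix. -/
noncomputable def linearVectorField (R : Type*) [CommRing R] (A : Matrix σ σ ℤ) :
    Derivation R (MvPolynomial σ R) (MvPolynomial σ R) :=
  mkDerivation R fun j => ∑ i, C (A i j : R) * X i

theorem linearVectorField_X {R : Type*} [CommRing R] (A : Matrix σ σ ℤ) (j : σ) :
    linearVectorField R A (X j) = ∑ i, C (A i j : R) * X i :=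
  mkDerivation_X ..

theorem linearVectorField_apply {R : Type*} [CommRing R] (A : Matrix σ σ ℤ)
    (p : MvPolynomial σ R) :
    linearVectorField R A p = ∑ i, ∑ j, C (A i j : R) * (X i * pderiv j p) := by
  classical
  have hsum : ∀ (D : σ → Derivation R (MvPolynomial σ R) (MvPolynomial σ R))
      (q : MvPolynomial σ R), (∑ i, D i) q = ∑ i, D i q := fun D q => by
    have := congrFun (map_sum Derivation.coeFnAddMonoidHom D Finset.univ) q
    rwa [Finset.sum_apply] at this
  have h : linearVectorField R A
      = ∑ i, ∑ j, (C (A i j : R) * X i : MvPolynomial σ R) • pderiv (R := R) j := by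
    refine derivation_ext fun k => ?_
    rw [linearVectorField_X]
    simp [hsum, pderiv_X, Pi.single_apply]
  rw [h]
  simp [hsum, mul_assoc]

theorem coeff_X_mul_pderiv {σ R : Type*} [CommRing R] [DecidableEq σ] (i j : σ)
    (p : MvPolynomial σ R) (m : σ →₀ ℕ) : coeff m (X i * pderiv j p) = if i ∈ m.support then
      coeff (m - Finsupp.single i 1 + Finsupp.single j 1) p *
        (((m - Finsupp.single i 1 : σ →₀ ℕ) j : ℕ) + 1 : R) else 0 := by
  rw [coeff_X_mul']
  split_ifs
  · rw [coeff_pderiv]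
  · rfl

/-- The apolar bilinear form, for which multiplication by `X i` is adjoint to `∂/∂X i`. -/
noncomputable def apolarForm (σ : Type*) :
    MvPolynomial σ ℚ →ₗ[ℚ] MvPolynomial σ ℚ →ₗ[ℚ] ℚ :=
  (basisMonomials σ ℚ).constr ℚ fun m => (m.prod fun _ k => (k.factorial : ℚ)) • lcoeff ℚ m

theorem apolarForm_monomial {σ : Type*} (m : σ →₀ ℕ) (q : MvPolynomial σ ℚ) :
    apolarForm σ (monomial m 1) q = (m.prod fun _ k => (k.factorial : ℚ)) * coeff m q := by
  have := (basisMonomials σ ℚ).constr_basis ℚ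
    (fun m => (m.prod fun _ k => (k.factorial : ℚ)) • lcoeff ℚ m) m
  rw [coe_basisMonomials] at this
  rw [apolarForm, this]
  rfl

theorem apolarForm_apply {σ : Type*} (p q : MvPolynomial σ ℚ) :
    apolarForm σ p q
      = ∑ m ∈ p.support, (m.prod fun _ k => (k.factorial : ℚ)) * (coeff m p * coeff m q) := by
  conv_lhs => rw [p.as_sum]
  rw [map_sum, LinearMap.sum_apply]
  refine Finset.sum_congr rfl fun m _ => ?_
  rw [← mul_one (coeff m p), ← smul_eq_mul, ← smul_monomial, map_smul, LinearMap.smul_apply,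
    apolarForm_monomial, smul_eq_mul, smul_eq_mul]
  ring

theorem apolarForm_comm {σ : Type*} (p q : MvPolynomial σ ℚ) :
    apolarForm σ p q = apolarForm σ q p := by
  classical
  rw [apolarForm_apply, apolarForm_apply,
    Finset.sum_subset (Finset.subset_union_left (s₂ := q.support)),
    Finset.sum_subset (Finset.subset_union_right (s₁ := p.support) (s₂ := q.support))]
  · exact Finset.sum_congr rfl fun m _ => by ring
  · intro m _ hm; rw [notMem_support_iff.mp hm]; ring
  · intro m _ hm; rw [notMem_support_iff.mp hm]; ring

theorem apolarForm_X_mul {σ : Type*} (i : σ) (p q : MvPolynomial σ ℚ) :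
    apolarForm σ (X i * p) q = apolarForm σ p (pderiv i q) := by
  classical
  induction p using MvPolynomial.induction_on' with
  | monomial m c =>
    rw [show (monomial m c : MvPolynomial σ ℚ) = c • monomial m 1 by
        rw [smul_monomial, smul_eq_mul, mul_one], mul_smul_comm, X, monomial_mul, mul_one]
    simp only [map_smul, LinearMap.smul_apply, apolarForm_monomial, coeff_pderiv, smul_eq_mul]
    have : ((Finsupp.single i 1 + m).prod fun _ k => (k.factorial : ℚ))
        = (m.prod fun _ k => (k.factorial : ℚ)) * (m i + 1) := by
      rw [Finsupp.prod_of_support_subset _ (s := insert i m.support) _ _ (by simp),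
        Finsupp.prod_of_support_subset m (s := insert i m.support) (by simp) _ (by simp),
        ← Finset.mul_prod_erase _ _ (Finset.mem_insert_self i _),
        ← Finset.mul_prod_erase _ _ (Finset.mem_insert_self i _),
        Finset.prod_congr rfl fun x (hx : x ∈ (insert i m.support).erase i) => by
          rw [Finsupp.add_apply, Finsupp.single_eq_of_ne (Finset.ne_of_mem_erase hx), zero_add]]
      · simp only [Finsupp.add_apply, Finsupp.single_eq_same, add_comm 1 (m i),
          Nat.factorial_succ]
        push_cast
        ring
      · intro x hx
        by_cases h : x = i
        · simp [h]
        · rw [Finsupp.mem_support_iff, Finsupp.add_apply, Finsupp.single_eq_of_ne h,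
            zero_add] at hx
          simp [hx]
    rw [this, add_comm (Finsupp.single i 1) m]
    ring
  | add p p' hp hp' => rw [mul_add, map_add, map_add, LinearMap.add_apply, LinearMap.add_apply,
      hp, hp']

theorem apolarForm_linearVectorField (A : Matrix σ σ ℤ) (p q : MvPolynomial σ ℚ) :
    apolarForm σ (linearVectorField ℚ A p) q
      = apolarForm σ p (linearVectorField ℚ A.transpose q) := by
  have hC : ∀ (c : ℚ) (r : MvPolynomial σ ℚ), C c * r = c • r := fun c r => (smul_eq_C_mul r c).symm
  have key : ∀ i j, apolarForm σ (X i * pderiv j p) q = apolarForm σ p (X j * pderiv i q) := by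
    intro i j
    rw [apolarForm_X_mul, apolarForm_comm, ← apolarForm_X_mul, apolarForm_comm]
  rw [linearVectorField_apply, linearVectorField_apply, Finset.sum_comm]
  simp only [hC, map_sum, map_smul, LinearMap.sum_apply, LinearMap.smul_apply, key,
    Matrix.transpose_apply]

/-- Apply an additive map to all coefficients of a polynomial. -/
noncomputable def mapCoefficients {σ R S : Type*} [CommRing R] [CommRing S] (ℓ : R →+ S)
    (p : MvPolynomial σ R) : MvPolynomial σ S :=
  AddMonoidAlgebra.map ℓ p

theorem coeff_mapCoefficients {σ R S : Type*} [CommRing R] [CommRing S] (ℓ : R →+ S)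
    (p : MvPolynomial σ R) (m : σ →₀ ℕ) : coeff m (mapCoefficients ℓ p) = ℓ (coeff m p) := by
  rfl

theorem mapCoefficients_linearVectorField {R S : Type*} [CommRing R] [CommRing S] (ℓ : R →+ S)
    (A : Matrix σ σ ℤ) (p : MvPolynomial σ R) :
    mapCoefficients ℓ (linearVectorField R A p)
      = linearVectorField S A (mapCoefficients ℓ p) := by
  classical
  ext m
  rw [coeff_mapCoefficients, linearVectorField_apply, linearVectorField_apply]
  simp only [coeff_sum, coeff_C_mul, coeff_X_mul_pderiv, map_sum]
  refine Finset.sum_congr rfl fun i _ => Finset.sum_congr rfl fun j _ => ?_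
  have hz : ∀ (z : ℤ) (x : R), ℓ (z * x) = z * ℓ x := fun z x => by
    rw [← zsmul_eq_mul, map_zsmul, zsmul_eq_mul]
  rw [hz]
  congr 1
  split_ifs
  · rw [coeff_mapCoefficients, mul_comm, mul_comm (ℓ _)]
    have := hz (((m - Finsupp.single i 1 : σ →₀ ℕ) j : ℕ) + 1 : ℤ)
    push_cast at this
    exact this _
  · exact map_zero ℓ

/-- The sum of the images of a family of linear vector fields meets the common kernel of the
transposed family trivially. -/
theorem eq_zero_of_linearVectorField_transpose_eq_zero {K κ : Type*} [Field K] [CharZero K]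
    [Fintype κ] (A : κ → Matrix σ σ ℤ) (h : κ → MvPolynomial σ K) {v : MvPolynomial σ K}
    (hv : v = ∑ k, linearVectorField K (A k) (h k))
    (h0 : ∀ k, linearVectorField K (A k).transpose v = 0) : v = 0 := by
  classical
  let bK := Module.Basis.ofVectorSpace ℚ K
  ext m
  rw [coeff_zero]
  refine bK.ext_elem fun i => ?_
  let ℓ : K →+ ℚ := (bK.coord i).toAddMonoidHom
  have hℓ0 : ∀ k, linearVectorField ℚ (A k).transpose (mapCoefficients ℓ v) = 0 := fun k => by
    rw [← mapCoefficients_linearVectorField, h0 k]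
    ext m
    rw [coeff_mapCoefficients, coeff_zero, map_zero, coeff_zero]
  have hℓv : mapCoefficients ℓ v
      = ∑ k, linearVectorField ℚ (A k) (mapCoefficients ℓ (h k)) := by
    ext m
    simp only [← mapCoefficients_linearVectorField, coeff_mapCoefficients, coeff_sum]
    rw [hv, coeff_sum, map_sum]
  have hself : apolarForm σ (mapCoefficients ℓ v) (mapCoefficients ℓ v) = 0 := by
    conv_lhs => enter [1]; rw [hℓv]
    simp only [map_sum, LinearMap.sum_apply, apolarForm_linearVectorField, hℓ0, map_zero,
      Finset.sum_const_zero]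
  have hzero : ℓ (coeff m v) = 0 := by
    by_contra hne
    rw [apolarForm_apply, Finset.sum_eq_zero_iff_of_nonneg] at hself
    · have h1 := hself m (mem_support_iff.mpr hne)
      rw [coeff_mapCoefficients, mul_eq_zero] at h1
      rcases h1 with h1 | h1
      · exact Finset.prod_ne_zero_iff.mpr
          (fun x _ => Nat.cast_ne_zero.mpr (Nat.factorial_ne_zero _)) h1
      · exact hne (mul_self_eq_zero.mp h1)
    · exact fun m' _ => mul_nonneg (Finset.prod_nonneg fun _ _ => Nat.cast_nonneg _)
        (mul_self_nonneg _)
  simpa [ℓ] using hzero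

end LinearVectorFields

section SlotFields

variable {𝕜 : Type} [Field 𝕜]

/-- Two opposite root vectors and two elements of the diagonal torus of the Lie algebra acting on
the slots `p, r, q, t` that annihilates `p ⊗ q + r ⊗ t`. -/
def slotMatrix (k : Fin 4) : Matrix (Fin 4) (Fin 4) ℤ :=
  ![!![0, 1, 0, 0; 0, 0, 0, 0; 0, 0, 0, 0; 0, 0, -1, 0],
    !![0, 0, 0, 0; 1, 0, 0, 0; 0, 0, 0, -1; 0, 0, 0, 0],
    !![1, 0, 0, 0; 0, 0, 0, 0; 0, 0, -1, 0; 0, 0, 0, 0],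
    !![0, 0, 0, 0; 0, 1, 0, 0; 0, 0, 0, 0; 0, 0, 0, -1]] k

/-- The action of `slotMatrix k` on the entries of four `2 × 2` matrices. -/
def entryMatrix (k : Fin 4) : Matrix FourMatrices FourMatrices ℤ :=
  Matrix.of fun u v => if u.2 = v.2 then slotMatrix k u.1 v.1 else 0

/-- The derivation given by `slotMatrix k`. -/
noncomputable def slotField (𝕜 : Type) [Field 𝕜] (k : Fin 4) :
    Derivation 𝕜 (MvPolynomial FourMatrices 𝕜) (MvPolynomial FourMatrices 𝕜) :=
  linearVectorField 𝕜 (entryMatrix k)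

theorem slotField_X (k s : Fin 4) (x : Fin 2 × Fin 2) :
    slotField 𝕜 k (X (s, x)) = ∑ s', C (slotMatrix k s' s : 𝕜) * X (s', x) := by
  rw [slotField, linearVectorField_X, Fintype.sum_prod_type]
  refine Finset.sum_congr rfl fun s' _ => ?_
  rw [Finset.sum_eq_single x]
  · simp [entryMatrix]
  · intro y _ hy
    simp [entryMatrix, hy]
  · simp

theorem transpose_entryMatrix (k : Fin 4) :
    (entryMatrix k).transpose = entryMatrix (![1, 0, 2, 3] k) := by
  fin_cases k <;> decide

theorem slotField_twoTerm (k : Fin 4) (f : MvPolynomial (Fin 2 × Fin 2 × Fin 2 × Fin 2) 𝕜) :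
    slotField 𝕜 k (twoTerm 𝕜 f) = 0 := by
  have := algHom_comp_derivation (twoTerm 𝕜) 0 (slotField 𝕜 k) (fun x => by
    obtain ⟨i, j, m, n⟩ := x
    rw [twoTerm_X]
    fin_cases k <;> simp [slotField_X, slotMatrix, Fin.sum_univ_four] <;> ring) f
  simpa using this.symm

end SlotFields

section PencilInvariants

variable {𝕜 : Type} [Field 𝕜]

/-- The relations between the coefficients of the pencils of determinants, as polynomials in the
entries of the four matrices. -/
noncomputable def pencilInvariant (𝕜 : Type) [Field 𝕜] (s : Fin 3) : MvPolynomial FourMatrices 𝕜 :=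
  aeval (quadraticInvariant 𝕜) (pencilRelation 𝕜 s)

theorem slotField_zero_pencilInvariant (s : Fin 3) :
    slotField 𝕜 0 (pencilInvariant 𝕜 s) =
      ![0, pencilInvariant 𝕜 0, -(2 * pencilInvariant 𝕜 1)] s := by
  fin_cases s <;>
    simp [pencilInvariant, pencilRelation, quadraticInvariant, slotField_X, slotMatrix,
      Fin.sum_univ_four] <;> ring

theorem slotField_one_pencilInvariant (s : Fin 3) :
    slotField 𝕜 1 (pencilInvariant 𝕜 s) =
      ![2 * pencilInvariant 𝕜 1, -pencilInvariant 𝕜 2, 0] s := by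
  fin_cases s <;>
    simp [pencilInvariant, pencilRelation, quadraticInvariant, slotField_X, slotMatrix,
      Fin.sum_univ_four] <;> ring

theorem slotField_pencilInvariant_one (k : Fin 4) (hk : 2 ≤ k) :
    slotField 𝕜 k (pencilInvariant 𝕜 1) = 0 := by
  fin_cases k <;> simp at hk <;>
    simp [pencilInvariant, pencilRelation, quadraticInvariant, slotField_X, slotMatrix,
      Fin.sum_univ_four] <;> ring

theorem exists_twoTerm_eq_pencilInvariant_combination (i j k l : Fin 2) :
    ∃ c ∈ Ideal.span (minorsAC_BD 𝕜 2 2 2 2), twoTerm 𝕜 c =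
      -(pencilInvariant 𝕜 0 * (X (1, i, j) * X (2, k, l))) +
        pencilInvariant 𝕜 1 * (X (0, i, j) * X (2, k, l) - X (1, i, j) * X (3, k, l)) -
        pencilInvariant 𝕜 2 * (X (0, i, j) * X (3, k, l)) := by
  let e : Fin 2 → Fin 2 → Fin 3 → Fin 2 × Fin 2 := fun x y =>
    ![![![(0, 0), (0, 1), (1, 0)], ![(0, 0), (0, 1), (1, 1)]],
      ![![(0, 0), (1, 0), (1, 1)], ![(0, 1), (1, 0), (1, 1)]]] x y
  refine ⟨C ((-1) ^ (i + j : ℕ)) * _, Ideal.mul_mem_left _ _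
    (Ideal.subset_span ⟨e i k, e j l, rfl⟩), ?_⟩
  rw [Matrix.det_fin_three]
  fin_cases i <;> fin_cases j <;> fin_cases k <;> fin_cases l <;>
    simp [e, twoTerm_X, pencilInvariant, pencilRelation, quadraticInvariant] <;> ring

end PencilInvariants

section SlotMonomials

variable {𝕜 : Type} [Field 𝕜]

/-- A monomial in the entries of a single one of the four matrices. -/
noncomputable def slotMonomial (𝕜 : Type) [Field 𝕜] (s : Fin 4) (l : List (Fin 2 × Fin 2)) :
    MvPolynomial FourMatrices 𝕜 :=
  (l.map fun x => X (s, x)).prod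

@[simp]
theorem slotMonomial_nil (s : Fin 4) : slotMonomial 𝕜 s [] = 1 := rfl

@[simp]
theorem slotMonomial_cons (s : Fin 4) (x : Fin 2 × Fin 2) (l : List (Fin 2 × Fin 2)) :
    slotMonomial 𝕜 s (x :: l) = X (s, x) * slotMonomial 𝕜 s l := by
  simp [slotMonomial]

theorem slotMonomial_induction {M : Submodule 𝕜 (MvPolynomial FourMatrices 𝕜)}
    (hM : ∀ l : Fin 4 → List (Fin 2 × Fin 2), ∏ s, slotMonomial 𝕜 s (l s) ∈ M)
    (f : MvPolynomial FourMatrices 𝕜) : f ∈ M := by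
  suffices h : f ∈ Submodule.span 𝕜
      (Set.range fun l : Fin 4 → List (Fin 2 × Fin 2) => ∏ s, slotMonomial 𝕜 s (l s)) from
    (Submodule.span_le.2 (by rintro _ ⟨l, rfl⟩; exact hM l)) h
  induction f using MvPolynomial.induction_on with
  | C a =>
    rw [C_eq_smul_one]
    exact Submodule.smul_mem _ _ (Submodule.subset_span ⟨fun _ => [], by simp⟩)
  | add p q hp hq => exact add_mem hp hq
  | mul_X p x hp =>
    rw [mul_comm]
    refine Submodule.span_induction (p := fun p _ => X x * p ∈ Submodule.span 𝕜 _) ?_ (by simp)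
      (fun p q _ _ hp hq => by rw [mul_add]; exact add_mem hp hq)
      (fun c p _ hp => by rw [mul_smul_comm]; exact Submodule.smul_mem _ _ hp) hp
    rintro _ ⟨l, rfl⟩
    refine Submodule.subset_span ⟨Function.update l x.1 (x.2 :: l x.1), ?_⟩
    dsimp only
    rw [← Finset.mul_prod_erase _ _ (Finset.mem_univ x.1), ← Finset.mul_prod_erase
      (a := x.1) (f := fun s => slotMonomial 𝕜 s (l s)) _ (Finset.mem_univ x.1)]
    rw [Function.update_self, slotMonomial_cons, mul_assoc]
    congr 2
    refine Finset.prod_congr rfl fun s hs => ?_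
    rw [Function.update_of_ne (Finset.ne_of_mem_erase hs)]

theorem slotField_slotMonomial_of_diagonal {k s : Fin 4} {c : ℤ}
    (h : ∀ s', slotMatrix k s' s = if s' = s then c else 0) (l : List (Fin 2 × Fin 2)) :
    slotField 𝕜 k (slotMonomial 𝕜 s l) = C ((l.length : 𝕜) * c) * slotMonomial 𝕜 s l := by
  induction l with
  | nil => simp
  | cons x l ih =>
    rw [slotMonomial_cons, Derivation.leibniz, ih, slotField_X]
    simp [h, apply_ite C, ite_mul]
    ring

theorem slotField_one_slotField_zero_slotMonomial_two (l : List (Fin 2 × Fin 2)) :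
    slotField 𝕜 1 (slotField 𝕜 0 (slotMonomial 𝕜 2 l)) = l.length * slotMonomial 𝕜 2 l := by
  induction l with
  | nil => simp
  | cons x l ih =>
    have h' : slotField 𝕜 1 (slotMonomial 𝕜 2 l) = 0 := by
      rw [slotField_slotMonomial_of_diagonal (c := 0) (by decide)]
      simp
    simp [slotField_X, slotMatrix, Fin.sum_univ_four, ih, h']
    ring

theorem X_mul_slotField_zero_slotMonomial_mem (I : Fin 2 × Fin 2) (A : MvPolynomial FourMatrices 𝕜)
    (l : List (Fin 2 × Fin 2)) (M : Submodule 𝕜 (MvPolynomial FourMatrices 𝕜))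
    (hM : ∀ J l', l'.length + 1 = l.length →
      twoTerm 𝕜 (X (I.1, I.2, J)) * (A * slotMonomial 𝕜 2 l') ∈ M) :
    X (1, I) * A * slotField 𝕜 0 (slotMonomial 𝕜 2 l) -
      (l.length : MvPolynomial FourMatrices 𝕜) * (X (0, I) * A * slotMonomial 𝕜 2 l) ∈ M := by
  induction l generalizing A with
  | nil => simp
  | cons J l ih =>
    have h := ih (X (2, J) * A) fun J' l' hl' => by
      have := hM J' (J :: l') (by simpa using hl')
      rw [slotMonomial_cons] at this
      convert this using 1
      ring
    convert sub_mem h (hM J l (by simp)) using 1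
    obtain ⟨k, m⟩ := J
    simp [slotField_X, slotMatrix, Fin.sum_univ_four, twoTerm_X]
    ring

theorem slotField_one_mul_slotField_zero_mem (l l' : List (Fin 2 × Fin 2))
    (A : MvPolynomial FourMatrices 𝕜) (M : Submodule 𝕜 (MvPolynomial FourMatrices 𝕜))
    (hM : ∀ (I J : Fin 2 × Fin 2) m m', m.length + 1 = l.length → m'.length + 1 = l'.length →
      twoTerm 𝕜 (X (I.1, I.2, J)) * (A * slotMonomial 𝕜 0 m * slotMonomial 𝕜 2 m') ∈ M) :
    A * slotField 𝕜 1 (slotMonomial 𝕜 0 l) * slotField 𝕜 0 (slotMonomial 𝕜 2 l') -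
      (l.length * l'.length : MvPolynomial FourMatrices 𝕜) *
        (A * slotMonomial 𝕜 0 l * slotMonomial 𝕜 2 l') ∈ M := by
  induction l generalizing A with
  | nil => simp
  | cons I l ih =>
    have h := ih (X (0, I) * A) fun I' J' m m' hm hm' => by
      have := hM I' J' (I :: m) m' (by simpa using hm) hm'
      rw [slotMonomial_cons] at this
      convert this using 1
      ring
    have h' := X_mul_slotField_zero_slotMonomial_mem I (A * slotMonomial 𝕜 0 l) l' M
      fun J m' hm' => hM I J l m' (by simp) hm'
    convert add_mem h h' using 1
    simp [slotField_X, slotMatrix, Fin.sum_univ_four]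
    ring

end SlotMonomials

section LiftableModuloFields

variable {𝕜 : Type} [Field 𝕜]

/-- Polynomials that agree with an element of `twoTerm 𝕜 J` up to derivatives along the
slot fields. -/
def liftableModuloFields (J : Ideal (MvPolynomial (Fin 2 × Fin 2 × Fin 2 × Fin 2) 𝕜)) :
    Submodule 𝕜 (MvPolynomial FourMatrices 𝕜) where
  carrier := {f | ∃ g ∈ J, ∃ h : Fin 4 → MvPolynomial FourMatrices 𝕜,
    f = twoTerm 𝕜 g + ∑ k, slotField 𝕜 k (h k)}
  zero_mem' := ⟨0, J.zero_mem, 0, by simp⟩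
  add_mem' := by
    rintro _ _ ⟨g, hg, h, rfl⟩ ⟨g', hg', h', rfl⟩
    refine ⟨g + g', J.add_mem hg hg', h + h', ?_⟩
    simp only [map_add, Pi.add_apply, Finset.sum_add_distrib]
    ring
  smul_mem' := by
    rintro c _ ⟨g, hg, h, rfl⟩
    exact ⟨c • g, Submodule.smul_of_tower_mem J c hg, c • h, by
      simp [Finset.smul_sum]⟩

variable {J : Ideal (MvPolynomial (Fin 2 × Fin 2 × Fin 2 × Fin 2) 𝕜)}

theorem twoTerm_mem_liftableModuloFields {g : MvPolynomial (Fin 2 × Fin 2 × Fin 2 × Fin 2) 𝕜}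
    (hg : g ∈ J) : twoTerm 𝕜 g ∈ liftableModuloFields J :=
  ⟨g, hg, 0, by simp⟩

theorem slotField_mem_liftableModuloFields (k : Fin 4) (h : MvPolynomial FourMatrices 𝕜) :
    slotField 𝕜 k h ∈ liftableModuloFields J :=
  ⟨0, J.zero_mem, Pi.single k h, by
    rw [Finset.sum_eq_single k (fun k' _ hk => by simp [hk]) (by simp)]
    simp⟩

theorem twoTerm_mul_mem_liftableModuloFields (g : MvPolynomial (Fin 2 × Fin 2 × Fin 2 × Fin 2) 𝕜)
    {f : MvPolynomial FourMatrices 𝕜} (hf : f ∈ liftableModuloFields J) :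
    twoTerm 𝕜 g * f ∈ liftableModuloFields J := by
  obtain ⟨g', hg', h, rfl⟩ := hf
  refine ⟨g * g', J.mul_mem_left _ hg', fun k => twoTerm 𝕜 g * h k, ?_⟩
  simp [mul_add, Finset.mul_sum, slotField_twoTerm]

theorem mem_liftableModuloFields_of_natCast_mul [CharZero 𝕜] {n : ℕ} (hn : n ≠ 0)
    {f : MvPolynomial FourMatrices 𝕜}
    (hf : (n : MvPolynomial FourMatrices 𝕜) * f ∈ liftableModuloFields J) :
    f ∈ liftableModuloFields J := by
  have := (liftableModuloFields J).smul_mem (n : 𝕜)⁻¹ hf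
  rwa [← map_natCast C, ← smul_eq_C_mul, smul_smul, inv_mul_cancel₀ (by exact_mod_cast hn),
    one_smul] at this

theorem pencilInvariant_zero_mul_add_mem (h : MvPolynomial FourMatrices 𝕜) :
    pencilInvariant 𝕜 0 * h + pencilInvariant 𝕜 1 * slotField 𝕜 0 h ∈ liftableModuloFields J := by
  convert slotField_mem_liftableModuloFields 0 (pencilInvariant 𝕜 1 * h) using 1
  simp [slotField_zero_pencilInvariant]
  ring

theorem pencilInvariant_two_mul_sub_mem (h : MvPolynomial FourMatrices 𝕜) :
    pencilInvariant 𝕜 2 * h - pencilInvariant 𝕜 1 * slotField 𝕜 1 h ∈ liftableModuloFields J := by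
  convert neg_mem (slotField_mem_liftableModuloFields 1 (pencilInvariant 𝕜 1 * h)) using 1
  simp [slotField_one_pencilInvariant]
  ring

theorem pencilInvariant_one_mul_slotField_sub_mem (h : MvPolynomial FourMatrices 𝕜) :
    pencilInvariant 𝕜 1 * slotField 𝕜 1 (slotField 𝕜 0 h) - 2 * (pencilInvariant 𝕜 1 * h) ∈
      liftableModuloFields J := by
  convert sub_mem (slotField_mem_liftableModuloFields 0 (pencilInvariant 𝕜 2 * h))
    (pencilInvariant_two_mul_sub_mem (J := J) (slotField 𝕜 0 h)) using 1
  simp [slotField_zero_pencilInvariant]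
  ring

theorem pencilInvariant_one_mem [CharZero 𝕜] : pencilInvariant 𝕜 1 ∈ liftableModuloFields J := by
  refine mem_liftableModuloFields_of_natCast_mul two_ne_zero ?_
  simpa using neg_mem (pencilInvariant_one_mul_slotField_sub_mem (J := J) 1)

theorem pencilInvariant_one_mul_X_mul_X_mem [CharZero 𝕜]
    (hJ : minorsAC_BD 𝕜 2 2 2 2 ⊆ J) (x y : Fin 2 × Fin 2) :
    pencilInvariant 𝕜 1 * (X (0, x) * X (2, y)) ∈ liftableModuloFields J := by
  obtain ⟨i, j⟩ := x
  obtain ⟨k, l⟩ := y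
  obtain ⟨c, hc, h⟩ := exists_twoTerm_eq_pencilInvariant_combination (𝕜 := 𝕜) i j k l
  have hc := twoTerm_mem_liftableModuloFields (Ideal.span_le.2 hJ hc)
  rw [h] at hc
  have h3 : pencilInvariant 𝕜 1 * (X (0, i, j) * X (2, k, l) - X (1, i, j) * X (3, k, l)) ∈
      liftableModuloFields J := by
    refine mem_liftableModuloFields_of_natCast_mul three_ne_zero ?_
    convert add_mem (add_mem hc (pencilInvariant_zero_mul_add_mem (X (1, i, j) * X (2, k, l))))
      (pencilInvariant_two_mul_sub_mem (X (0, i, j) * X (3, k, l))) using 1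
    simp [slotField_X, slotMatrix, Fin.sum_univ_four]
    ring
  refine mem_liftableModuloFields_of_natCast_mul two_ne_zero ?_
  convert add_mem h3 (twoTerm_mul_mem_liftableModuloFields (X (i, j, k, l))
    pencilInvariant_one_mem) using 1
  simp [twoTerm_X]
  ring

theorem pencilInvariant_one_mul_slotMonomial_mem [CharZero 𝕜]
    (hJ : minorsAC_BD 𝕜 2 2 2 2 ⊆ J) {n : ℕ} {l l' : List (Fin 2 × Fin 2)} (hl : l.length = n)
    (hl' : l'.length = n) :
    pencilInvariant 𝕜 1 * (slotMonomial 𝕜 0 l * slotMonomial 𝕜 2 l') ∈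
      liftableModuloFields J := by
  induction n using Nat.strong_induction_on generalizing l l' with
  | _ n ih =>
    by_cases h1 : n = 1
    · subst h1
      obtain ⟨x, rfl⟩ := List.length_eq_one_iff.1 hl
      obtain ⟨y, rfl⟩ := List.length_eq_one_iff.1 hl'
      simpa using pencilInvariant_one_mul_X_mul_X_mem hJ x y
    · have hE : slotField 𝕜 0 (slotMonomial 𝕜 0 l) = 0 := by
        rw [slotField_slotMonomial_of_diagonal (c := 0) (by decide)]
        simp
      have h := slotField_one_mul_slotField_zero_mem l l' 1
        ((liftableModuloFields J).comap (LinearMap.mulLeft 𝕜 (pencilInvariant 𝕜 1)))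
        fun x y m m' hm hm' => by
          rw [Submodule.mem_comap, LinearMap.mulLeft_apply, mul_left_comm, one_mul]
          exact twoTerm_mul_mem_liftableModuloFields _ (ih m.length (by omega) rfl (by omega))
      rw [Submodule.mem_comap, LinearMap.mulLeft_apply] at h
      have h2 := pencilInvariant_one_mul_slotField_sub_mem (J := J)
        (slotMonomial 𝕜 0 l * slotMonomial 𝕜 2 l')
      have h3 := sub_mem h2 h
      simp [hE, slotField_one_slotField_zero_slotMonomial_two, hl, hl'] at h3
      obtain rfl | hn : n = 0 ∨ 2 ≤ n := by omega
      · refine mem_liftableModuloFields_of_natCast_mul two_ne_zero ?_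
        convert neg_mem h3 using 1
        simp
        ring
      · refine mem_liftableModuloFields_of_natCast_mul (n := n * n + n - 2) ?_ ?_
        · have : 2 * 2 ≤ n * n := Nat.mul_le_mul hn hn
          omega
        · convert h3 using 1
          rw [Nat.cast_sub (by nlinarith)]
          push_cast
          ring

theorem pencilInvariant_one_mul_balanced_mem [CharZero 𝕜]
    (hJ : minorsAC_BD 𝕜 2 2 2 2 ⊆ J) {n : ℕ} {p r q t : List (Fin 2 × Fin 2)}
    (hp : p.length = q.length) (hr : r.length = n) (ht : t.length = n) :
    pencilInvariant 𝕜 1 * (slotMonomial 𝕜 0 p * slotMonomial 𝕜 1 r * slotMonomial 𝕜 2 q *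
      slotMonomial 𝕜 3 t) ∈ liftableModuloFields J := by
  induction n generalizing p r q t with
  | zero =>
    obtain rfl := List.length_eq_zero_iff.1 hr
    obtain rfl := List.length_eq_zero_iff.1 ht
    simpa using pencilInvariant_one_mul_slotMonomial_mem hJ hp rfl
  | succ n ih =>
    obtain ⟨x, r, rfl⟩ := List.exists_cons_of_length_eq_add_one hr
    obtain ⟨y, t, rfl⟩ := List.exists_cons_of_length_eq_add_one ht
    have h := ih hp (by simpa using hr) (by simpa using ht)
    have h' := ih (p := x :: p) (q := y :: q) (by simpa using hp) (by simpa using hr)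
      (by simpa using ht)
    convert sub_mem (twoTerm_mul_mem_liftableModuloFields (X (x.1, x.2, y)) h) h' using 1
    obtain ⟨k, l⟩ := y
    simp [twoTerm_X]
    ring

theorem pencilInvariant_one_mul_mem [CharZero 𝕜]
    (hJ : minorsAC_BD 𝕜 2 2 2 2 ⊆ J) (h : MvPolynomial FourMatrices 𝕜) :
    pencilInvariant 𝕜 1 * h ∈ liftableModuloFields J := by
  refine slotMonomial_induction
    (M := (liftableModuloFields J).comap (LinearMap.mulLeft 𝕜 (pencilInvariant 𝕜 1)))
    (fun l => ?_) h
  rw [Submodule.mem_comap, LinearMap.mulLeft_apply, Fin.prod_univ_four]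
  have key : ∀ (k : Fin 4) (n : ℤ), n ≠ 0 → slotField 𝕜 k (pencilInvariant 𝕜 1 *
      (slotMonomial 𝕜 0 (l 0) * slotMonomial 𝕜 1 (l 1) * slotMonomial 𝕜 2 (l 2) *
        slotMonomial 𝕜 3 (l 3))) = C (n : 𝕜) * (pencilInvariant 𝕜 1 *
      (slotMonomial 𝕜 0 (l 0) * slotMonomial 𝕜 1 (l 1) * slotMonomial 𝕜 2 (l 2) *
        slotMonomial 𝕜 3 (l 3))) →
      pencilInvariant 𝕜 1 * (slotMonomial 𝕜 0 (l 0) * slotMonomial 𝕜 1 (l 1) *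
        slotMonomial 𝕜 2 (l 2) * slotMonomial 𝕜 3 (l 3)) ∈ liftableModuloFields J := by
    intro k n hn h
    have := (liftableModuloFields J).smul_mem (n : 𝕜)⁻¹
      (slotField_mem_liftableModuloFields k (pencilInvariant 𝕜 1 * (slotMonomial 𝕜 0 (l 0) *
        slotMonomial 𝕜 1 (l 1) * slotMonomial 𝕜 2 (l 2) * slotMonomial 𝕜 3 (l 3))))
    rwa [h, ← smul_eq_C_mul, smul_smul, inv_mul_cancel₀ (by exact_mod_cast hn), one_smul] at this
  by_cases h0 : (l 0).length = (l 2).length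
  · by_cases h1 : (l 1).length = (l 3).length
    · exact pencilInvariant_one_mul_balanced_mem hJ h0 h1 rfl
    · refine key 3 ((l 1).length - (l 3).length) (by omega) ?_
      simp only [Derivation.leibniz, smul_eq_mul, slotField_pencilInvariant_one 3 (by decide)]
      rw [slotField_slotMonomial_of_diagonal (s := 0) (c := 0) (by decide),
        slotField_slotMonomial_of_diagonal (s := 1) (c := 1) (by decide),
        slotField_slotMonomial_of_diagonal (s := 2) (c := 0) (by decide),
        slotField_slotMonomial_of_diagonal (s := 3) (c := -1) (by decide)]
      simp
      ring
  · refine key 2 ((l 0).length - (l 2).length) (by omega) ?_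
    simp only [Derivation.leibniz, smul_eq_mul, slotField_pencilInvariant_one 2 (by decide)]
    rw [slotField_slotMonomial_of_diagonal (s := 0) (c := 1) (by decide),
      slotField_slotMonomial_of_diagonal (s := 1) (c := 0) (by decide),
      slotField_slotMonomial_of_diagonal (s := 2) (c := -1) (by decide),
      slotField_slotMonomial_of_diagonal (s := 3) (c := 0) (by decide)]
    simp
    ring

theorem mem_liftableModuloFields_of_mem_span [CharZero 𝕜] (hJ : minorsAC_BD 𝕜 2 2 2 2 ⊆ J)
    {f : MvPolynomial FourMatrices 𝕜} (hf : f ∈ Ideal.span (Set.range (pencilInvariant 𝕜))) :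
    f ∈ liftableModuloFields J := by
  obtain ⟨c, rfl⟩ := Ideal.mem_span_range_iff_exists_fun.1 hf
  refine sum_mem fun s _ => ?_
  rw [mul_comm]
  fin_cases s
  · convert sub_mem (pencilInvariant_zero_mul_add_mem (c 0))
      (pencilInvariant_one_mul_mem hJ (slotField 𝕜 0 (c 0))) using 1
    simp
  · exact pencilInvariant_one_mul_mem hJ (c 1)
  · convert add_mem (pencilInvariant_two_mul_sub_mem (c 2))
      (pencilInvariant_one_mul_mem hJ (slotField 𝕜 1 (c 2))) using 1
    simp

theorem secantIdeal_le_of_minors_subset [CharZero 𝕜] (hJ : minorsAC_BD 𝕜 2 2 2 2 ⊆ J)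
    (hJ' : minorsAB_CD 𝕜 2 2 2 2 ⊆ J) : secantIdeal 𝕜 2 2 2 2 2 ≤ J := by
  intro f hf
  obtain ⟨g, hg, h, hfg⟩ := mem_liftableModuloFields_of_mem_span hJ
    (twoTerm_mem_span_pencilRelation hf)
  have h0 : twoTerm 𝕜 (f - g) = 0 := by
    refine eq_zero_of_linearVectorField_transpose_eq_zero entryMatrix h ?_ fun k => ?_
    · rw [map_sub, hfg, add_sub_cancel_left]
      rfl
    · rw [transpose_entryMatrix]
      exact slotField_twoTerm _ _
  have := add_mem (Ideal.span_le.2 hJ' (ker_twoTerm_le h0)) hg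
  rwa [sub_add_cancel] at this

end LiftableModuloFields

section EasyInclusion

variable {𝕜 : Type} [Field 𝕜] {a b c d : ℕ}

theorem det_two_term_eq_zero {R : Type*} [CommRing R] (u v : Fin 2 → Fin 3 → R) :
    (Matrix.of fun i j => ∑ s, u s i * v s j).det = 0 := by
  simp [Matrix.det_fin_three, Fin.sum_univ_two]
  ring

theorem det_X_mem_secantIdeal {ι κ : Type*}
    (e : ι → κ → Fin a × Fin b × Fin c × Fin d)
    (he : ∀ (u : Fin a → 𝕜) (v : Fin b → 𝕜) (w : Fin c → 𝕜) (z : Fin d → 𝕜),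
      ∃ (f : ι → 𝕜) (g : κ → 𝕜), ∀ i k, f i * g k =
        u (e i k).1 * v (e i k).2.1 * w (e i k).2.2.1 * z (e i k).2.2.2)
    (ρ : Fin 3 → ι) (γ : Fin 3 → κ) :
    Matrix.det (Matrix.of fun i j : Fin 3 => (X (e (ρ i) (γ j)) :
      MvPolynomial (Fin a × Fin b × Fin c × Fin d) 𝕜)) ∈ secantIdeal 𝕜 a b c d 2 := by
  rw [mem_secantIdeal]
  rintro T ⟨u, v, w, z, hT⟩
  choose f g h using fun s => he (u s) (v s) (w s) (z s)
  rw [RingHom.map_det, ← det_two_term_eq_zero (fun s i => f s (ρ i)) (fun s j => g s (γ j))]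
  congr 1
  ext i j
  simp [hT, h]

theorem span_allMinors_le_secantIdeal :
    Ideal.span (minorsA 𝕜 a b c d ∪ minorsB 𝕜 a b c d ∪ minorsC 𝕜 a b c d ∪
      minorsD 𝕜 a b c d ∪ minorsAB_CD 𝕜 a b c d ∪ minorsAC_BD 𝕜 a b c d ∪
      minorsAD_BC 𝕜 a b c d) ≤ secantIdeal 𝕜 a b c d 2 := by
  rw [Ideal.span_le]
  rintro _ ((((((⟨ρ, γ, rfl⟩ | ⟨ρ, γ, rfl⟩) | ⟨ρ, γ, rfl⟩) | ⟨ρ, γ, rfl⟩) | ⟨ρ, γ, rfl⟩) |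
    ⟨ρ, γ, rfl⟩) | ⟨ρ, γ, rfl⟩)
  · exact det_X_mem_secantIdeal (ι := Fin a) (κ := Fin b × Fin c × Fin d)
      (fun i k => (i, k))
      (fun u v w z => ⟨u, fun k => v k.1 * w k.2.1 * z k.2.2, fun i k => by ring⟩) ρ γ
  · exact det_X_mem_secantIdeal (ι := Fin b) (κ := Fin a × Fin c × Fin d)
      (fun i k => (k.1, i, k.2.1, k.2.2))
      (fun u v w z => ⟨v, fun k => u k.1 * w k.2.1 * z k.2.2, fun i k => by ring⟩) ρ γ
  · exact det_X_mem_secantIdeal (ι := Fin c) (κ := Fin a × Fin b × Fin d)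
      (fun i k => (k.1, k.2.1, i, k.2.2))
      (fun u v w z => ⟨w, fun k => u k.1 * v k.2.1 * z k.2.2, fun i k => by ring⟩) ρ γ
  · exact det_X_mem_secantIdeal (ι := Fin d) (κ := Fin a × Fin b × Fin c)
      (fun i k => (k.1, k.2.1, k.2.2, i))
      (fun u v w z => ⟨z, fun k => u k.1 * v k.2.1 * w k.2.2, fun i k => by ring⟩) ρ γ
  · exact det_X_mem_secantIdeal (ι := Fin a × Fin b) (κ := Fin c × Fin d)
      (fun i k => (i.1, i.2, k.1, k.2))
      (fun u v w z => ⟨fun i => u i.1 * v i.2, fun k => w k.1 * z k.2, fun i k => by ring⟩) ρ γ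
  · exact det_X_mem_secantIdeal (ι := Fin a × Fin c) (κ := Fin b × Fin d)
      (fun i k => (i.1, k.1, i.2, k.2))
      (fun u v w z => ⟨fun i => u i.1 * w i.2, fun k => v k.1 * z k.2, fun i k => by ring⟩) ρ γ
  · exact det_X_mem_secantIdeal (ι := Fin a × Fin d) (κ := Fin b × Fin c)
      (fun i k => (i.1, k.1, k.2, i.2))
      (fun u v w z => ⟨fun i => u i.1 * z i.2, fun k => v k.1 * w k.2, fun i k => by ring⟩) ρ γ

end EasyInclusion

/-- **Theorem 3 (Landsberg–Weyman; GSS conjecture for four factors).**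
The homogeneous ideal of `σ₂(PA* × PB* × PC* × PD*)` is generated in degree three by the
modules defining the subspace variety `Sub_{2,2,2,2}` (the 3×3 minors of the four
one-versus-three flattenings) together with the two copies of
`S₂₁A ⊗ S₂₁B ⊗ S₂₁C ⊗ S₂₁D` spanned by the 3×3 minors of the two-versus-two flattenings
(the minors of two of them already suffice).  In particular the ideal of `σ₂` is
generated by the 3×3 minors of all flattenings. -/
theorem sigma2_fourFactors_ideal_generated_by_flattenings
    (K : Type) [Field K] [CharZero K] (a b c d : ℕ)
    (ha : 2 ≤ a) (hb : 2 ≤ b) (hc : 2 ≤ c) (hd : 2 ≤ d) :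
    secantIdeal K a b c d 2 =
      Ideal.span (minorsA K a b c d ∪ minorsB K a b c d ∪ minorsC K a b c d ∪
        minorsD K a b c d ∪ minorsAB_CD K a b c d ∪ minorsAC_BD K a b c d) ∧
    secantIdeal K a b c d 2 =
      Ideal.span (minorsA K a b c d ∪ minorsB K a b c d ∪ minorsC K a b c d ∪
        minorsD K a b c d ∪ minorsAB_CD K a b c d ∪ minorsAC_BD K a b c d ∪
        minorsAD_BC K a b c d) := by
  have h : secantIdeal K a b c d 2 ≤ _ := secantIdeal_le_span_flatteningMinors ha hb hc hd
    (secantIdeal_le_of_minors_subset (fun f hf => Ideal.subset_span (Or.inr hf))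
      fun f hf => Ideal.subset_span (Or.inl hf))
  have h' := Ideal.span_mono (α := MvPolynomial (Fin a × Fin b × Fin c × Fin d) K)
    (Set.subset_union_left (s := flatteningMinors K a b c d) (t := minorsAD_BC K a b c d))
  exact ⟨le_antisymm h (h'.trans span_allMinors_le_secantIdeal),
    le_antisymm (h.trans h') span_allMinors_le_secantIdeal⟩
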